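/- For every a ∈ ℂ with a ≠ 0: the Fatou components A_0(a) and A_∞(a) of R_a are distinct (in particular disjoint), both A_0(a) and A_∞(a) are simply connected as subspaces of the Riemann sphere ℂ̂, and the critical point −1 is not contained in A_∞(a). -/

import Mathlib

open Filter Topology OnePoint

/-- The Riemann sphere as the one-point compactification of `ℂ`. -/
notation "RSphere" => OnePoint ℂ

/-- The quadratic rational map `R_a(z) = a/(z² + 2z)` on the Riemann sphere, with
`R_a(0) = R_a(−2) = ∞` and `R_a(∞) = 0`. -/
noncomputable def Rhat (a : ℂ) : RSphere → RSphere := fun z =>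
  match z with
  | ∞ => ((0 : ℂ) : RSphere)
  | (w : ℂ) => if w ^ 2 + 2 * w = 0 then ∞ else ((a / (w ^ 2 + 2 * w) : ℂ) : RSphere)

/-- The basin of attraction of the superattracting 2-cycle `∞ ↦ 0 ↦ ∞` of `R_a`. -/
def sphereBasin (a : ℂ) : Set RSphere :=
  {z | Tendsto (fun n => (Rhat a)^[2 * n] z) atTop (𝓝 ∞) ∨
       Tendsto (fun n => (Rhat a)^[2 * n] z) atTop (𝓝 ((0 : ℂ) : RSphere))}

/-- `A_∞(a)`: the connected component of the basin containing `∞`. -/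
noncomputable def Ainf (a : ℂ) : Set RSphere := connectedComponentIn (sphereBasin a) ∞

/-- `A_0(a)`: the connected component of the basin containing `0`. -/
noncomputable def Azero (a : ℂ) : Set RSphere :=
  connectedComponentIn (sphereBasin a) ((0 : ℂ) : RSphere)

/-- `P_∞`: the parameters for which the critical value `−a` lies in `A_∞(a)`. -/
def Pinf : Set ℂ := {a | a ≠ 0 ∧ (((-a : ℂ) : RSphere) ∈ Ainf a)}


section Charts

/-- The inversion chart `x ↦ 1/x` around infinity. -/
noncomputable def invChart (x : ℂ) : OnePoint ℂ := if x = 0 then ∞ else ((x⁻¹ : ℂ) : OnePoint ℂ)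

/-- Inversion of the sphere. -/
noncomputable def invSph : OnePoint ℂ → OnePoint ℂ := fun z =>
  match z with
  | ∞ => ((0 : ℂ) : OnePoint ℂ)
  | (w : ℂ) => invChart w

theorem invSph_infty : invSph ∞ = ((0 : ℂ) : OnePoint ℂ) := rfl
theorem invSph_coe (w : ℂ) : invSph (w : OnePoint ℂ) = invChart w := rfl

theorem invSph_invol : Function.Involutive invSph := by
  intro z
  induction z using OnePoint.rec with
  | infty => simp [invSph_infty, invSph_coe, invChart]
  | coe w =>
    rw [invSph_coe, invChart]
    split_ifs with h
    · simp [invSph_infty, h]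
    · simp [invSph_coe, invChart, h]

theorem invChart_zero : invChart 0 = ∞ := by simp [invChart]

theorem tendsto_coe_cobounded :
    Tendsto ((↑) : ℂ → OnePoint ℂ) (Bornology.cobounded ℂ) (𝓝 ∞) := by
  rw [Metric.cobounded_eq_cocompact, ← coclosedCompact_eq_cocompact]
  exact OnePoint.tendsto_coe_infty

theorem continuous_invChart : Continuous invChart := by
  rw [continuous_iff_continuousAt]
  intro x
  by_cases hx : x = 0
  · subst hx
    rw [continuousAt_iff_punctured_nhds, invChart_zero]
    have h1 : Tendsto (fun x : ℂ => ((x⁻¹ : ℂ) : OnePoint ℂ)) (𝓝[≠] 0) (𝓝 ∞) :=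
      tendsto_coe_cobounded.comp tendsto_inv₀_nhdsNE_zero
    refine h1.congr' ?_
    filter_upwards [self_mem_nhdsWithin] with y hy
    have : y ≠ 0 := hy
    simp [invChart, this]
  · have h1 : ContinuousAt (fun x : ℂ => ((x⁻¹ : ℂ) : OnePoint ℂ)) x :=
      OnePoint.continuous_coe.continuousAt.comp (continuousAt_inv₀ hx)
    refine h1.congr ?_
    filter_upwards [isOpen_ne.mem_nhds hx] with y hy
    have : y ≠ 0 := hy
    simp [invChart, this]

theorem continuous_invSph : Continuous invSph := by
  rw [continuous_iff_continuousAt]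
  intro z
  induction z using OnePoint.rec with
  | infty =>
    rw [OnePoint.continuousAt_infty', coclosedCompact_eq_cocompact,
      ← Metric.cobounded_eq_cocompact, invSph_infty]
    have h1 : Tendsto (fun x : ℂ => ((x⁻¹ : ℂ) : OnePoint ℂ)) (Bornology.cobounded ℂ)
        (𝓝 ((0 : ℂ) : OnePoint ℂ)) :=
      (OnePoint.continuous_coe.tendsto 0).comp tendsto_inv₀_cobounded
    refine h1.congr' ?_
    have : ∀ᶠ x : ℂ in Bornology.cobounded ℂ, x ≠ 0 := by
      exact Bornology.eventually_ne_cobounded 0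
    filter_upwards [this] with y hy
    simp [invSph_coe, invChart, hy]
  | coe w =>
    rw [OnePoint.continuousAt_coe]
    exact continuous_invChart.continuousAt

/-- Inversion as a homeomorphism. -/
noncomputable def invHomeo : OnePoint ℂ ≃ₜ OnePoint ℂ where
  toFun := invSph
  invFun := invSph
  left_inv := invSph_invol
  right_inv := invSph_invol
  continuous_toFun := continuous_invSph
  continuous_invFun := continuous_invSph

theorem isOpenEmbedding_invChart : IsOpenEmbedding invChart :=
  invHomeo.isOpenEmbedding.comp OnePoint.isOpenEmbedding_coe

theorem invChart_ne_zero (x : ℂ) : invChart x ≠ ((0 : ℂ) : OnePoint ℂ) := by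
  rw [invChart]; split_ifs with h <;> simp [h]

theorem mem_range_invChart {z : OnePoint ℂ} (hz : z ≠ ((0 : ℂ) : OnePoint ℂ)) :
    ∃ x, invChart x = z := by
  induction z using OnePoint.rec with
  | infty => exact ⟨0, invChart_zero⟩
  | coe w =>
    have : w ≠ 0 := by simpa using hz
    exact ⟨w⁻¹, by simp [invChart, this]⟩

/-- translation of the sphere -/
noncomputable def trSph (c : ℂ) : OnePoint ℂ ≃ₜ OnePoint ℂ := (Homeomorph.addRight c).onePointCongr

theorem trSph_coe (c w : ℂ) : trSph c (w : OnePoint ℂ) = ((w + c : ℂ) : OnePoint ℂ) := rfl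
theorem trSph_infty (c : ℂ) : trSph c ∞ = ∞ := rfl

instance : LocallyPathConnectedSpace (OnePoint ℂ) where
  path_connected_basis x := by
    have key : ∀ (e : ℂ → OnePoint ℂ), IsOpenEmbedding e → ∀ y : ℂ, ∀ s ∈ 𝓝 (e y),
        ∃ t ∈ 𝓝 (e y), IsPathConnected t ∧ t ⊆ s := by
      intro e he y s hs
      have h1 : e ⁻¹' s ∈ 𝓝 y := he.continuous.continuousAt hs
      obtain ⟨ε, hε, hb⟩ := Metric.mem_nhds_iff.1 h1
      refine ⟨e '' Metric.ball y ε, he.isOpenMap.image_mem_nhds (Metric.ball_mem_nhds y hε), ?_, ?_⟩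
      · exact ((convex_ball y ε).isPathConnected ⟨y, Metric.mem_ball_self hε⟩).image he.continuous
      · exact Set.image_subset_iff.2 hb
    have key2 : ∀ s ∈ 𝓝 x, ∃ t ∈ 𝓝 x, IsPathConnected t ∧ t ⊆ s := by
      induction x using OnePoint.rec with
      | infty => have := key _ isOpenEmbedding_invChart 0; rwa [invChart_zero] at this
      | coe w => exact key _ OnePoint.isOpenEmbedding_coe w
    refine ⟨fun s => ⟨fun hs => ?_, ?_⟩⟩
    · obtain ⟨t, h1, h2, h3⟩ := key2 s hs
      exact ⟨t, ⟨h1, h2⟩, h3⟩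
    · rintro ⟨t, ⟨h1, h2⟩, h3⟩
      exact mem_of_superset h1 h3

end Charts

section RmapBasics

variable {a : ℂ}

theorem Rhat_infty (a : ℂ) : Rhat a ∞ = ((0 : ℂ) : OnePoint ℂ) := rfl
theorem Rhat_coe (a w : ℂ) : Rhat a (w : OnePoint ℂ) =
    if w ^ 2 + 2 * w = 0 then ∞ else ((a / (w ^ 2 + 2 * w) : ℂ) : OnePoint ℂ) := rfl
theorem Rhat_zero (a : ℂ) : Rhat a ((0 : ℂ) : OnePoint ℂ) = ∞ := by simp [Rhat_coe]

/-- chart `v ↦ 1/v - 1` -/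
noncomputable def iotaA (v : ℂ) : OnePoint ℂ := trSph (-1) (invChart v)
/-- chart `u ↦ a u/(1-u)` -/
noncomputable def kapA (a u : ℂ) : OnePoint ℂ := trSph (-a) (invChart ((1 - u) / a))
/-- chart `v ↦ v - 1` -/
noncomputable def iotaB (v : ℂ) : OnePoint ℂ := ((v - 1 : ℂ) : OnePoint ℂ)
/-- chart `x ↦ a/(x-1)` -/
noncomputable def kapB (a x : ℂ) : OnePoint ℂ := invChart ((x - 1) / a)

theorem isOpenEmbedding_iotaA : IsOpenEmbedding iotaA :=
  (trSph (-1)).isOpenEmbedding.comp isOpenEmbedding_invChart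

theorem isOpenEmbedding_iotaB : IsOpenEmbedding iotaB :=
  OnePoint.isOpenEmbedding_coe.comp (Homeomorph.subRight (1 : ℂ)).isOpenEmbedding

theorem isOpenEmbedding_kapA (ha : a ≠ 0) : IsOpenEmbedding (kapA a) := by
  have h := (trSph (-a)).isOpenEmbedding.comp (isOpenEmbedding_invChart.comp
    ((Homeomorph.subLeft (1 : ℂ)).trans (Homeomorph.mulRight₀ a⁻¹ (inv_ne_zero ha))).isOpenEmbedding)
  convert h using 1
  funext u
  simp [kapA, div_eq_mul_inv]

theorem isOpenEmbedding_kapB (ha : a ≠ 0) : IsOpenEmbedding (kapB a) := by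
  have h := (isOpenEmbedding_invChart.comp
    ((Homeomorph.subRight (1 : ℂ)).trans (Homeomorph.mulRight₀ a⁻¹ (inv_ne_zero ha))).isOpenEmbedding)
  convert h using 1
  funext u
  simp [kapB, div_eq_mul_inv]

theorem Rhat_iotaA (ha : a ≠ 0) (v : ℂ) : Rhat a (iotaA v) = kapA a (v ^ 2) := by
  by_cases hv : v = 0
  · subst hv
    simp [iotaA, invChart_zero, trSph_infty, Rhat_infty, kapA, invChart, ha, trSph_coe]
  · have h1 : iotaA v = ((v⁻¹ - 1 : ℂ) : OnePoint ℂ) := by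
      simp [iotaA, invChart, hv, trSph_coe, sub_eq_add_neg]
    rw [h1, Rhat_coe]
    have h2 : (v⁻¹ - 1) ^ 2 + 2 * (v⁻¹ - 1) = (1 - v ^ 2) / v ^ 2 := by field_simp; ring
    rw [h2]
    by_cases h3 : 1 - v ^ 2 = 0
    · simp [h3, kapA, invChart_zero, trSph_infty]
    · have h4 : (1 - v ^ 2) / v ^ 2 ≠ 0 := by positivity
      have h5 : (1 - v ^ 2) / a ≠ 0 := div_ne_zero h3 ha
      rw [if_neg h4, kapA, invChart, if_neg h5, trSph_coe]
      congr 1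
      field_simp
      ring

theorem Rhat_iotaB (ha : a ≠ 0) (v : ℂ) : Rhat a (iotaB v) = kapB a (v ^ 2) := by
  rw [iotaB, Rhat_coe]
  have h2 : (v - 1) ^ 2 + 2 * (v - 1) = v ^ 2 - 1 := by ring
  rw [h2, kapB, invChart]
  by_cases h3 : v ^ 2 - 1 = 0
  · simp [h3]
  · have h5 : (v ^ 2 - 1) / a ≠ 0 := div_ne_zero h3 ha
    rw [if_neg h3, if_neg h5]
    congr 1
    field_simp

theorem range_iotaA {z : OnePoint ℂ} (hz : z ≠ ((-1 : ℂ) : OnePoint ℂ)) : ∃ v, iotaA v = z := by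
  have : (trSph (-1)).symm z ≠ ((0 : ℂ) : OnePoint ℂ) := by
    intro h
    apply hz
    rw [← (trSph (-1)).apply_symm_apply z, h, trSph_coe, zero_add]
  obtain ⟨x, hx⟩ := mem_range_invChart this
  exact ⟨x, by rw [iotaA, hx, Homeomorph.apply_symm_apply]⟩

theorem range_iotaB {z : OnePoint ℂ} (hz : z ≠ ∞) : ∃ v, iotaB v = z := by
  obtain ⟨w, rfl⟩ := OnePoint.ne_infty_iff_exists.1 hz
  exact ⟨w + 1, by simp [iotaB]⟩

theorem range_kapA (ha : a ≠ 0) {z : OnePoint ℂ} (hz : z ≠ ((-a : ℂ) : OnePoint ℂ)) :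
    ∃ v, kapA a v = z := by
  have : (trSph (-a)).symm z ≠ ((0 : ℂ) : OnePoint ℂ) := by
    intro h
    apply hz
    rw [← (trSph (-a)).apply_symm_apply z, h, trSph_coe, zero_add]
  obtain ⟨x, hx⟩ := mem_range_invChart this
  refine ⟨1 - x * a, ?_⟩
  have : (1 - (1 - x * a)) / a = x := by field_simp; ring
  rw [kapA, this, hx, Homeomorph.apply_symm_apply]

theorem range_kapB (ha : a ≠ 0) {z : OnePoint ℂ} (hz : z ≠ ((0 : ℂ) : OnePoint ℂ)) :
    ∃ v, kapB a v = z := by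
  obtain ⟨x, hx⟩ := mem_range_invChart hz
  refine ⟨1 + x * a, ?_⟩
  have : (1 + x * a - 1) / a = x := by field_simp; ring
  rw [kapB, this, hx]

theorem Rhat_neg_one (ha : a ≠ 0) : Rhat a ((-1 : ℂ) : OnePoint ℂ) = ((-a : ℂ) : OnePoint ℂ) := by
  rw [Rhat_coe, if_neg (by norm_num)]
  congr 1
  norm_num [div_neg]

theorem kapA_ne (u : ℂ) : kapA a u ≠ ((-a : ℂ) : OnePoint ℂ) := by
  intro h
  have : trSph (-a) (invChart ((1 - u) / a)) = trSph (-a) ((0 : ℂ) : OnePoint ℂ) := by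
    rw [trSph_coe, zero_add]; exact h
  exact invChart_ne_zero _ ((trSph (-a)).injective this)

theorem kapB_ne (u : ℂ) : kapB a u ≠ ((0 : ℂ) : OnePoint ℂ) := invChart_ne_zero _

theorem continuous_Rhat (ha : a ≠ 0) : Continuous (Rhat a) := by
  have key : ∀ (e k : ℂ → OnePoint ℂ), IsOpenEmbedding e → Continuous k →
      (∀ v, Rhat a (e v) = k (v ^ 2)) → ∀ v, ContinuousAt (Rhat a) (e v) := by
    intro e k he hk h v
    rw [← he.continuousAt_iff]
    have : Rhat a ∘ e = fun v => k (v ^ 2) := funext h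
    rw [this]
    fun_prop
  rw [continuous_iff_continuousAt]
  intro z
  by_cases hz : z = ∞
  · obtain ⟨v, rfl⟩ := range_iotaA (z := z) (by rw [hz]; simp)
    exact key _ _ isOpenEmbedding_iotaA (isOpenEmbedding_kapA ha).continuous (Rhat_iotaA ha) v
  · obtain ⟨v, rfl⟩ := range_iotaB hz
    exact key _ _ isOpenEmbedding_iotaB (isOpenEmbedding_kapB ha).continuous (Rhat_iotaB ha) v

end RmapBasics

open Filter Topology OnePoint

section Basin

variable {a : ℂ}

/-- The second iterate. -/
noncomputable def Tm (a : ℂ) : OnePoint ℂ → OnePoint ℂ := fun z => Rhat a (Rhat a z)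

theorem Rhat_iter_two (a : ℂ) (n : ℕ) : (Rhat a)^[2 * n] = (Tm a)^[n] := by
  rw [Function.iterate_mul]; rfl

theorem continuous_Tm (ha : a ≠ 0) : Continuous (Tm a) :=
  (continuous_Rhat ha).comp (continuous_Rhat ha)

theorem Tm_iter_Rhat (a : ℂ) (n : ℕ) (z : OnePoint ℂ) :
    (Tm a)^[n] (Rhat a z) = Rhat a ((Tm a)^[n] z) := by
  have : Function.Commute (Rhat a) (Tm a) := fun z => rfl
  exact ((this.iterate_right n) z).symm

/-- Trapping radius. -/
noncomputable def rad (a : ℂ) : ℝ := min 1 (‖a‖ / 24)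

theorem rad_pos (ha : a ≠ 0) : 0 < rad a := by
  have := norm_pos_iff.2 ha
  exact lt_min one_pos (by positivity)

theorem Tm_coe_small (ha : a ≠ 0) {w : ℂ} (hw : ‖w‖ ≤ rad a) :
    ∃ w' : ℂ, Tm a (w : OnePoint ℂ) = (w' : OnePoint ℂ) ∧ ‖w'‖ ≤ ‖w‖ / 2 := by
  have hA := norm_pos_iff.2 ha
  have h1 : ‖w‖ ≤ 1 := hw.trans (min_le_left _ _)
  have h2 : ‖w‖ ≤ ‖a‖ / 24 := hw.trans (min_le_right _ _)
  have h0 := norm_nonneg w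
  set q := w ^ 2 + 2 * w with hq
  have hqn : ‖q‖ ≤ 3 * ‖w‖ := by
    calc ‖q‖ ≤ ‖w ^ 2‖ + ‖2 * w‖ := norm_add_le _ _
      _ = ‖w‖ ^ 2 + 2 * ‖w‖ := by simp
      _ ≤ 3 * ‖w‖ := by nlinarith
  by_cases hq0 : q = 0
  · refine ⟨0, ?_, by rw [norm_zero]; positivity⟩
    rw [Tm, Rhat_coe, if_pos hq0, Rhat_infty]
  · have h3 : 3 * ‖a‖ / 4 ≤ ‖a + 2 * q‖ := by
      have : ‖a‖ ≤ ‖a + 2 * q‖ + ‖2 * q‖ := by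
        calc ‖a‖ = ‖(a + 2 * q) - 2 * q‖ := by ring_nf
          _ ≤ _ := norm_sub_le _ _
      rw [norm_mul] at this
      norm_num at this
      linarith
    have h4 : a + 2 * q ≠ 0 := by
      intro h; rw [h, norm_zero] at h3; linarith
    refine ⟨q ^ 2 / (a + 2 * q), ?_, ?_⟩
    · rw [Tm, Rhat_coe, if_neg hq0, Rhat_coe]
      have h5 : (a / q) ^ 2 + 2 * (a / q) = a * (a + 2 * q) / q ^ 2 := by
        field_simp
      rw [← hq, h5, if_neg (by positivity)]
      congr 1
      field_simp
    · rw [norm_div, norm_pow, div_le_iff₀ (by linarith)]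
      have h6 : ‖q‖ ^ 2 ≤ 9 * ‖w‖ ^ 2 := by nlinarith [norm_nonneg q]
      have h7 : ‖w‖ / 2 * (3 * ‖a‖ / 4) ≤ ‖w‖ / 2 * ‖a + 2 * q‖ := by gcongr
      nlinarith

/-- closed trapping disk -/
noncomputable def Dbar (a : ℂ) : Set (OnePoint ℂ) := (↑) '' Metric.closedBall (0 : ℂ) (rad a)
/-- open trapping disk -/
noncomputable def Dop (a : ℂ) : Set (OnePoint ℂ) := (↑) '' Metric.ball (0 : ℂ) (rad a)

theorem isOpen_Dop (a : ℂ) : IsOpen (Dop a) :=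
  OnePoint.isOpenEmbedding_coe.isOpenMap _ Metric.isOpen_ball

theorem isClosed_Dbar (a : ℂ) : IsClosed (Dbar a) :=
  ((isCompact_closedBall (0 : ℂ) (rad a)).image OnePoint.continuous_coe).isClosed

theorem Dop_sub_Dbar (a : ℂ) : Dop a ⊆ Dbar a := Set.image_mono Metric.ball_subset_closedBall

theorem zero_mem_Dop (ha : a ≠ 0) : ((0 : ℂ) : OnePoint ℂ) ∈ Dop a :=
  ⟨0, Metric.mem_ball_self (rad_pos ha), rfl⟩

theorem Tm_Dbar (ha : a ≠ 0) {z : OnePoint ℂ} (hz : z ∈ Dbar a) : Tm a z ∈ Dop a := by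
  obtain ⟨w, hw, rfl⟩ := hz
  obtain ⟨w', h1, h2⟩ := Tm_coe_small ha (mem_closedBall_zero_iff.1 hw)
  refine ⟨w', ?_, h1.symm⟩
  have := mem_closedBall_zero_iff.1 hw
  have := rad_pos ha
  rw [mem_ball_zero_iff]
  linarith

theorem Tm_iter_small (ha : a ≠ 0) {w : ℂ} (hw : ‖w‖ ≤ rad a) (n : ℕ) :
    ∃ w' : ℂ, (Tm a)^[n] (w : OnePoint ℂ) = (w' : OnePoint ℂ) ∧ ‖w'‖ ≤ ‖w‖ * (1 / 2) ^ n := by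
  induction n with
  | zero => exact ⟨w, rfl, by simp⟩
  | succ n ih =>
    obtain ⟨w', h1, h2⟩ := ih
    have h3 : ‖w‖ * (1 / 2) ^ n ≤ ‖w‖ :=
      mul_le_of_le_one_right (norm_nonneg w) (pow_le_one₀ (by norm_num) (by norm_num))
    obtain ⟨w'', h4, h5⟩ := Tm_coe_small ha (w := w') (by linarith)
    refine ⟨w'', ?_, ?_⟩
    · rw [Function.iterate_succ_apply', h1, h4]
    · rw [pow_succ]; linarith

/-- basin of 0 under the second iterate -/
def B0 (a : ℂ) : Set (OnePoint ℂ) :=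
  {z | Tendsto (fun n => (Tm a)^[n] z) atTop (𝓝 ((0 : ℂ) : OnePoint ℂ))}
/-- basin of infinity under the second iterate -/
def Binf (a : ℂ) : Set (OnePoint ℂ) :=
  {z | Tendsto (fun n => (Tm a)^[n] z) atTop (𝓝 ∞)}

theorem sphereBasin_eq (a : ℂ) : sphereBasin a = B0 a ∪ Binf a := by
  ext z
  simp only [sphereBasin, Rhat_iter_two, Set.mem_union, Set.mem_setOf_eq, B0, Binf]
  exact or_comm

theorem Dbar_sub_B0 (ha : a ≠ 0) : Dbar a ⊆ B0 a := by
  rintro _ ⟨w, hw, rfl⟩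
  choose f h1 h2 using Tm_iter_small ha (mem_closedBall_zero_iff.1 hw)
  have h3 : Tendsto f atTop (𝓝 0) := by
    apply squeeze_zero_norm h2
    have := (tendsto_pow_atTop_nhds_zero_of_lt_one (r := (1 / 2 : ℝ)) (by norm_num)
      (by norm_num)).const_mul ‖w‖
    simpa using this
  exact ((OnePoint.continuous_coe.tendsto 0).comp h3).congr fun n => (h1 n).symm

theorem mem_B0_iter (n : ℕ) {z : OnePoint ℂ} : (Tm a)^[n] z ∈ B0 a ↔ z ∈ B0 a := by
  simp only [B0, Set.mem_setOf_eq, ← Function.iterate_add_apply]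
  exact tendsto_add_atTop_iff_nat (f := fun k => (Tm a)^[k] z) n

theorem mem_B0_iff (ha : a ≠ 0) {z : OnePoint ℂ} : z ∈ B0 a ↔ ∃ n, (Tm a)^[n] z ∈ Dop a := by
  constructor
  · intro h
    exact (h.eventually ((isOpen_Dop a).mem_nhds (zero_mem_Dop ha))).exists
  · rintro ⟨n, hn⟩
    exact (mem_B0_iter n).1 (Dbar_sub_B0 ha (Dop_sub_Dbar a hn))

theorem isOpen_B0 (ha : a ≠ 0) : IsOpen (B0 a) := by
  have : B0 a = ⋃ n, (Tm a)^[n] ⁻¹' (Dop a) := by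
    ext z; simp [mem_B0_iff ha]
  rw [this]
  exact isOpen_iUnion fun n => (isOpen_Dop a).preimage ((continuous_Tm ha).iterate n)

theorem Rhat_mem_B0 (ha : a ≠ 0) {z : OnePoint ℂ} : Rhat a z ∈ B0 a ↔ z ∈ Binf a := by
  constructor
  · intro h
    have h1 : Tendsto (fun n => Rhat a ((Tm a)^[n] (Rhat a z))) atTop (𝓝 ∞) := by
      have := ((continuous_Rhat ha).tendsto ((0 : ℂ) : OnePoint ℂ)).comp h
      rwa [Rhat_zero] at this
    refine (tendsto_add_atTop_iff_nat 1).1 (h1.congr fun n => ?_)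
    rw [Tm_iter_Rhat, Function.iterate_succ_apply', Tm]
  · intro h
    have h1 : Tendsto (fun n => Rhat a ((Tm a)^[n] z)) atTop (𝓝 ((0 : ℂ) : OnePoint ℂ)) :=
      ((continuous_Rhat ha).tendsto ∞).comp h
    exact h1.congr fun n => (Tm_iter_Rhat a n z).symm

theorem Rhat_mem_Binf (ha : a ≠ 0) {z : OnePoint ℂ} : Rhat a z ∈ Binf a ↔ z ∈ B0 a := by
  rw [← Rhat_mem_B0 ha]
  exact mem_B0_iter 1

theorem isOpen_Binf (ha : a ≠ 0) : IsOpen (Binf a) := by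
  have : Binf a = Rhat a ⁻¹' (B0 a) := by ext z; exact (Rhat_mem_B0 ha).symm
  rw [this]
  exact (isOpen_B0 ha).preimage (continuous_Rhat ha)

theorem disjoint_B0_Binf (a : ℂ) : Disjoint (B0 a) (Binf a) := by
  rw [Set.disjoint_left]
  intro z h1 h2
  have := tendsto_nhds_unique h1 h2
  simp at this

theorem zero_mem_B0 (ha : a ≠ 0) : ((0 : ℂ) : OnePoint ℂ) ∈ B0 a :=
  Dbar_sub_B0 ha (Dop_sub_Dbar a (zero_mem_Dop ha))

theorem infty_mem_Binf (ha : a ≠ 0) : ∞ ∈ Binf a := by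
  rw [← Rhat_mem_B0 ha, Rhat_infty]; exact zero_mem_B0 ha

theorem zero_mem_Azero (ha : a ≠ 0) : ((0 : ℂ) : OnePoint ℂ) ∈ Azero a :=
  mem_connectedComponentIn (by rw [sphereBasin_eq]; exact Or.inl (zero_mem_B0 ha))

theorem infty_mem_Ainf (ha : a ≠ 0) : ∞ ∈ Ainf a :=
  mem_connectedComponentIn (by rw [sphereBasin_eq]; exact Or.inr (infty_mem_Binf ha))

theorem isOpen_sphereBasin (ha : a ≠ 0) : IsOpen (sphereBasin a) := by
  rw [sphereBasin_eq]; exact (isOpen_B0 ha).union (isOpen_Binf ha)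

theorem isOpen_Azero (ha : a ≠ 0) : IsOpen (Azero a) := (isOpen_sphereBasin ha).connectedComponentIn
theorem isOpen_Ainf (ha : a ≠ 0) : IsOpen (Ainf a) := (isOpen_sphereBasin ha).connectedComponentIn
theorem isPreconnected_Azero (a : ℂ) : IsPreconnected (Azero a) := isPreconnected_connectedComponentIn
theorem isPreconnected_Ainf (a : ℂ) : IsPreconnected (Ainf a) := isPreconnected_connectedComponentIn

theorem Azero_sub_B0 (ha : a ≠ 0) : Azero a ⊆ B0 a := by
  refine (isPreconnected_Azero a).subset_left_of_subset_union (isOpen_B0 ha) (isOpen_Binf ha)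
    (disjoint_B0_Binf a) ?_ ⟨_, zero_mem_Azero ha, zero_mem_B0 ha⟩
  rw [← sphereBasin_eq]
  exact connectedComponentIn_subset _ _

theorem Ainf_sub_Binf (ha : a ≠ 0) : Ainf a ⊆ Binf a := by
  refine (isPreconnected_Ainf a).subset_right_of_subset_union (isOpen_B0 ha) (isOpen_Binf ha)
    (disjoint_B0_Binf a) ?_ ⟨_, infty_mem_Ainf ha, infty_mem_Binf ha⟩
  rw [← sphereBasin_eq]
  exact connectedComponentIn_subset _ _

theorem disjoint_Azero_Ainf (ha : a ≠ 0) : Disjoint (Azero a) (Ainf a) :=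
  (disjoint_B0_Binf a).mono (Azero_sub_B0 ha) (Ainf_sub_Binf ha)

theorem sub_Azero (ha : a ≠ 0) {C : Set (OnePoint ℂ)} (hC : IsPreconnected C)
    (h0 : ((0 : ℂ) : OnePoint ℂ) ∈ C) (h : C ⊆ B0 a) : C ⊆ Azero a :=
  hC.subset_connectedComponentIn h0 (h.trans (by rw [sphereBasin_eq]; exact Set.subset_union_left))

theorem sub_Ainf (ha : a ≠ 0) {C : Set (OnePoint ℂ)} (hC : IsPreconnected C)
    (h0 : ∞ ∈ C) (h : C ⊆ Binf a) : C ⊆ Ainf a :=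
  hC.subset_connectedComponentIn h0 (h.trans (by rw [sphereBasin_eq]; exact Set.subset_union_right))

theorem Rhat_Azero (ha : a ≠ 0) {z : OnePoint ℂ} (hz : z ∈ Azero a) : Rhat a z ∈ Ainf a := by
  refine sub_Ainf ha ((isPreconnected_Azero a).image _ (continuous_Rhat ha).continuousOn)
    ⟨_, zero_mem_Azero ha, Rhat_zero a⟩ ?_ ⟨z, hz, rfl⟩
  rintro _ ⟨w, hw, rfl⟩
  exact (Rhat_mem_Binf ha).2 (Azero_sub_B0 ha hw)

theorem Rhat_Ainf (ha : a ≠ 0) {z : OnePoint ℂ} (hz : z ∈ Ainf a) : Rhat a z ∈ Azero a := by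
  refine sub_Azero ha ((isPreconnected_Ainf a).image _ (continuous_Rhat ha).continuousOn)
    ⟨_, infty_mem_Ainf ha, Rhat_infty a⟩ ?_ ⟨z, hz, rfl⟩
  rintro _ ⟨w, hw, rfl⟩
  exact (Rhat_mem_B0 ha).2 (Ainf_sub_Binf ha hw)

theorem infty_not_mem_Azero (ha : a ≠ 0) : ∞ ∉ Azero a := fun h =>
  Set.disjoint_left.1 (disjoint_Azero_Ainf ha) h (infty_mem_Ainf ha)

theorem zero_not_mem_Ainf (ha : a ≠ 0) : ((0 : ℂ) : OnePoint ℂ) ∉ Ainf a := fun h =>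
  Set.disjoint_left.1 (disjoint_Azero_Ainf ha) (zero_mem_Azero ha) h

/-- compact exhaustion -/
noncomputable def Lc (a : ℂ) (n : ℕ) : Set (OnePoint ℂ) := Azero a ∩ (Tm a)^[n] ⁻¹' (Dbar a)
/-- open exhaustion -/
noncomputable def Lo (a : ℂ) (n : ℕ) : Set (OnePoint ℂ) := Azero a ∩ (Tm a)^[n] ⁻¹' (Dop a)

theorem isOpen_Lo (ha : a ≠ 0) (n : ℕ) : IsOpen (Lo a n) :=
  (isOpen_Azero ha).inter ((isOpen_Dop a).preimage ((continuous_Tm ha).iterate n))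

theorem isClosed_Lc (ha : a ≠ 0) (n : ℕ) : IsClosed (Lc a n) := by
  have hD : IsClosed ((Tm a)^[n] ⁻¹' (Dbar a)) :=
    (isClosed_Dbar a).preimage ((continuous_Tm ha).iterate n)
  refine isClosed_of_closure_subset fun z hz => ?_
  have h1 : z ∈ (Tm a)^[n] ⁻¹' (Dbar a) :=
    closure_minimal Set.inter_subset_right hD hz
  refine ⟨?_, h1⟩
  have h2 : z ∈ closure (Azero a) := closure_mono Set.inter_subset_left hz
  have h3 : IsPreconnected (insert z (Azero a)) :=
    (isPreconnected_Azero a).subset_closure (Set.subset_insert _ _)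
      (Set.insert_subset h2 subset_closure)
  refine sub_Azero ha h3 (Set.mem_insert_of_mem _ (zero_mem_Azero ha)) ?_ (Set.mem_insert _ _)
  exact Set.insert_subset ((mem_B0_iter n).1 (Dbar_sub_B0 ha h1)) (Azero_sub_B0 ha)

theorem Lo_sub_Lc (a : ℂ) (n : ℕ) : Lo a n ⊆ Lc a n := fun _ h => ⟨h.1, Dop_sub_Dbar a h.2⟩

theorem Lc_sub_Lo_succ (ha : a ≠ 0) (n : ℕ) : Lc a n ⊆ Lo a (n + 1) := fun z h =>
  ⟨h.1, by
    have := Tm_Dbar ha h.2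
    rwa [← Function.iterate_succ_apply' (Tm a) n z] at this⟩

theorem Lo_mono (ha : a ≠ 0) : Monotone (Lo a) :=
  monotone_nat_of_le_succ fun n => (Lo_sub_Lc a n).trans (Lc_sub_Lo_succ ha n)

theorem Lc_mono (ha : a ≠ 0) : Monotone (Lc a) :=
  monotone_nat_of_le_succ fun n => (Lc_sub_Lo_succ ha n).trans (Lo_sub_Lc a _)

theorem Tm_Lc (ha : a ≠ 0) {n : ℕ} {z : OnePoint ℂ} (hz : z ∈ Lc a n) : Tm a z ∈ Lo a n := by
  refine ⟨Rhat_Ainf ha (Rhat_Azero ha hz.1), ?_⟩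
  have h := Tm_Dbar ha hz.2
  show (Tm a)^[n] (Tm a z) ∈ Dop a
  rwa [← Function.iterate_succ_apply, Function.iterate_succ_apply']

theorem exists_mem_Lo (ha : a ≠ 0) {z : OnePoint ℂ} (hz : z ∈ Azero a) : ∃ n, z ∈ Lo a n := by
  obtain ⟨n, hn⟩ := (mem_B0_iff ha).1 (Azero_sub_B0 ha hz)
  exact ⟨n, hz, hn⟩

theorem compact_sub_Lo (ha : a ≠ 0) {C : Set (OnePoint ℂ)} (hC : IsCompact C) (h : C ⊆ Azero a) :
    ∃ n, C ⊆ Lo a n := by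
  refine hC.elim_directed_cover (Lo a) (isOpen_Lo ha) ?_ (Lo_mono ha).directed_le
  intro z hz
  exact Set.mem_iUnion.2 (exists_mem_Lo ha (h hz))

theorem zero_mem_Lo (ha : a ≠ 0) (n : ℕ) : ((0 : ℂ) : OnePoint ℂ) ∈ Lo a n :=
  Lo_mono ha (Nat.zero_le n) ⟨zero_mem_Azero ha, zero_mem_Dop ha⟩

end Basin

open Filter Topology OnePoint

section Contraction

theorem contraction_deriv {W Z : Set ℂ} {g : ℂ → ℂ} {t : ℝ} (ht : 0 < t) (hW : IsOpen W)
    (hg : DifferentiableOn ℂ g W) (hZW : Z ⊆ W) (hgZ : ∀ z ∈ W, g z ∈ Z)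
    (hG : ∀ c ∈ W, ∀ z ∈ W, g z + t * (g z - g c) ∈ W) (n : ℕ) :
    ∀ h : ℂ → ℂ, DifferentiableOn ℂ h W → (∀ z ∈ W, ‖h z‖ ≤ 1) → ∀ z ρ, 0 < ρ →
      Metric.closedBall z ρ ⊆ W → ‖deriv (fun w => h (g^[n] w)) z‖ ≤ (1 + t)⁻¹ ^ n / ρ := by
  have hmaps : ∀ n, ∀ z ∈ W, g^[n] z ∈ W := by
    intro n
    induction n with
    | zero => intro z hz; exact hz
    | succ n ih =>
      intro z hz
      rw [Function.iterate_succ_apply']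
      exact hZW (hgZ _ (ih z hz))
  have hdiff : ∀ n, DifferentiableOn ℂ (g^[n]) W := by
    intro n
    induction n with
    | zero => exact differentiableOn_id
    | succ n ih =>
      rw [Function.iterate_succ']
      exact hg.comp ih (hmaps n)
  induction n with
  | zero =>
    intro h hh hb z ρ hρ hball
    simp only [Function.iterate_zero, id, pow_zero]
    refine Complex.norm_deriv_le_of_forall_mem_sphere_norm_le hρ ?_ ?_
    · apply DifferentiableOn.diffContOnCl
      exact hh.mono (Metric.closure_ball_subset_closedBall.trans hball)
    · intro w hw
      exact hb w (hball (Metric.sphere_subset_closedBall hw))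
  | succ n ih =>
    intro h hh hb z ρ hρ hball
    have hz : z ∈ W := hball (Metric.mem_closedBall_self hρ.le)
    set c := g^[n] z with hc
    have hcW : c ∈ W := hmaps n z hz
    have hgc : g c ∈ W := hZW (hgZ _ hcW)
    have hGd : DifferentiableOn ℂ (fun w => g w + t * (g w - g c)) W :=
      hg.add ((hg.sub_const _).const_mul _)
    have h1 := ih (fun w => h (g w + t * (g w - g c))) (hh.comp hGd (hG c hcW))
      (fun w hw => hb _ (hG c hcW w hw)) z ρ hρ hball
    have dn : HasDerivAt (g^[n]) (deriv (g^[n]) z) z :=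
      ((hdiff n).differentiableAt (hW.mem_nhds hz)).hasDerivAt
    have dg : HasDerivAt g (deriv g c) c := (hg.differentiableAt (hW.mem_nhds hcW)).hasDerivAt
    have dh : HasDerivAt h (deriv h (g c)) (g c) :=
      (hh.differentiableAt (hW.mem_nhds hgc)).hasDerivAt
    have e1 : HasDerivAt (fun w => h (g^[n + 1] w))
        (deriv h (g c) * (deriv g c * deriv (g^[n]) z)) z := by
      have dg2 : HasDerivAt (fun w => g (g^[n] w)) (deriv g c * deriv (g^[n]) z) z :=
        HasDerivAt.comp z (h₂ := g) (by rw [← hc]; exact dg) dn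
      have := HasDerivAt.comp z (h₂ := h) (h := fun w => g (g^[n] w)) (by rw [← hc]; exact dh) dg2
      refine this.congr_of_eventuallyEq (Eventually.of_forall fun w => ?_)
      simp only [Function.iterate_succ_apply', Function.comp]
    have e2 : HasDerivAt (fun w => h (g (g^[n] w) + t * (g (g^[n] w) - g c)))
        (deriv h (g c) * (deriv g c * deriv (g^[n]) z + t * (deriv g c * deriv (g^[n]) z))) z := by
      have dg2 : HasDerivAt (fun w => g (g^[n] w)) (deriv g c * deriv (g^[n]) z) z :=
        HasDerivAt.comp z (h₂ := g) (by rw [← hc]; exact dg) dn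
      have dg3 : HasDerivAt (fun w => g (g^[n] w) + t * (g (g^[n] w) - g c))
        (deriv g c * deriv (g^[n]) z + t * (deriv g c * deriv (g^[n]) z)) z :=
        dg2.add ((dg2.sub_const _).const_mul _)
      exact HasDerivAt.comp z (h₂ := h) (by rw [← hc]; simpa using dh) dg3
    rw [e1.deriv]
    rw [e2.deriv] at h1
    have e3 : deriv h (g c) * (deriv g c * deriv (g^[n]) z + t * (deriv g c * deriv (g^[n]) z))
      = ((1 + t : ℝ) : ℂ) * (deriv h (g c) * (deriv g c * deriv (g^[n]) z)) := by push_cast; ring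
    rw [e3, norm_mul, Complex.norm_real, Real.norm_of_nonneg (by positivity)] at h1
    rw [pow_succ, mul_comm (_ ^ n), mul_div_assoc, le_inv_mul_iff₀ (by positivity)]
    exact h1

theorem contraction_cover {W Z : Set ℂ} {g : ℂ → ℂ} {M : ℝ} (hM : 0 < M) (hW : IsOpen W)
    (hWM : ∀ z ∈ W, ‖z‖ ≤ M)
    (hg : DifferentiableOn ℂ g W) (hZ : IsCompact Z) (hZW : Z ⊆ W) (hgZ : ∀ z ∈ W, g z ∈ Z) :
    ∃ N : ℕ, ∀ ε > 0, ∃ n, ∃ S : Finset ℂ, S.card ≤ N ∧ ∀ z ∈ W, ∃ c ∈ S, dist (g^[n] z) c < ε := by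
  obtain ⟨δ, hδ, hδW⟩ := hZ.exists_thickening_subset_open hW hZW
  have hball : ∀ z ∈ Z, Metric.ball z δ ⊆ W := fun z hz =>
    (Metric.ball_subset_thickening hz δ).trans hδW
  set t := δ / (3 * M) with htd
  have ht : 0 < t := by positivity
  have hG : ∀ c ∈ W, ∀ z ∈ W, g z + t * (g z - g c) ∈ W := by
    intro c hc z hz
    apply hball _ (hgZ z hz)
    rw [Metric.mem_ball, dist_eq_norm, add_sub_cancel_left, norm_mul, Complex.norm_real,
      Real.norm_of_nonneg ht.le]
    have h1 : ‖g z - g c‖ ≤ 2 * M := by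
      have := norm_sub_le (g z) (g c)
      have := hWM _ (hZW (hgZ z hz))
      have := hWM _ (hZW (hgZ c hc))
      linarith
    calc t * ‖g z - g c‖ ≤ t * (2 * M) := by gcongr
      _ = 2 * δ / 3 := by rw [htd]; field_simp
      _ < δ := by linarith
  obtain ⟨F, hFZ, hFfin, hFcov⟩ := hZ.finite_cover_balls (e := δ / 3) (by positivity)
  obtain ⟨F, rfl⟩ := hFfin.exists_finset_coe
  classical
  refine ⟨F.card, fun ε hε => ?_⟩
  have hlim : Tendsto (fun n : ℕ => M * (1 + t)⁻¹ ^ n) atTop (𝓝 0) := by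
    have := (tendsto_pow_atTop_nhds_zero_of_lt_one (r := (1 + t)⁻¹) (by positivity)
      (inv_lt_one_of_one_lt₀ (by linarith))).const_mul M
    simpa using this
  obtain ⟨n, hn⟩ := (hlim.eventually (gt_mem_nhds hε)).exists
  refine ⟨n + 1, F.image (g^[n]), Finset.card_image_le, fun z hz => ?_⟩
  obtain ⟨c, hc, hzc⟩ := Set.mem_iUnion₂.1 (hFcov (hgZ z hz))
  refine ⟨g^[n] c, Finset.mem_image_of_mem _ hc, ?_⟩
  rw [Function.iterate_succ_apply]
  have hcZ := hFZ hc
  have hD : ∀ w ∈ Metric.ball c (δ / 3), DifferentiableAt ℂ (g^[n]) w := by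
    have hmaps : ∀ n, ∀ z ∈ W, g^[n] z ∈ W := by
      intro n
      induction n with
      | zero => intro z hz; exact hz
      | succ n ih =>
        intro z hz
        rw [Function.iterate_succ_apply']
        exact hZW (hgZ _ (ih z hz))
    have hdiff : ∀ n, DifferentiableOn ℂ (g^[n]) W := by
      intro n
      induction n with
      | zero => exact differentiableOn_id
      | succ n ih =>
        rw [Function.iterate_succ']
        exact hg.comp ih (hmaps n)
    intro w hw
    exact (hdiff n).differentiableAt (hW.mem_nhds (hball c hcZ (Metric.ball_subset_ball (by linarith) hw)))
  have hB : ∀ w ∈ Metric.ball c (δ / 3), ‖deriv (g^[n]) w‖ ≤ M * ((1 + t)⁻¹ ^ n / (δ / 3)) := by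
    intro w hw
    have h1 := contraction_deriv ht hW hg hZW hgZ hG n (fun x => (M : ℂ)⁻¹ * x)
      (differentiableOn_id.const_mul _) (fun x hx => by
        rw [norm_mul, norm_inv, Complex.norm_real, Real.norm_of_nonneg hM.le,
          inv_mul_le_iff₀ hM, mul_one]
        exact hWM x hx) w (δ / 3) (by positivity) (fun x hx => by
          apply hball c hcZ
          rw [Metric.mem_closedBall] at hx
          rw [Metric.mem_ball] at hw ⊢
          linarith [dist_triangle x w c])
    rw [deriv_const_mul _ (hD w hw), norm_mul, norm_inv, Complex.norm_real,
      Real.norm_of_nonneg hM.le, inv_mul_le_iff₀ hM] at h1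
    exact h1
  have h2 := (convex_ball c (δ / 3)).norm_image_sub_le_of_norm_deriv_le hD hB
    (Metric.mem_ball_self (by positivity)) hzc
  rw [dist_eq_norm]
  refine lt_of_le_of_lt (h2.trans ?_) hn
  rw [Metric.mem_ball, dist_eq_norm] at hzc
  calc M * ((1 + t)⁻¹ ^ n / (δ / 3)) * ‖g z - c‖ ≤ M * ((1 + t)⁻¹ ^ n / (δ / 3)) * (δ / 3) := by
        gcongr
    _ = M * (1 + t)⁻¹ ^ n := by field_simp

theorem contraction_no_rays {W Z : Set ℂ} {g : ℂ → ℂ} {M m : ℝ} (hM : 0 < M) (hm : 0 < m)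
    (hW : IsOpen W) (hWM : ∀ z ∈ W, ‖z‖ ≤ M) (hWm : ∀ z ∈ W, m ≤ ‖z‖)
    (hg : DifferentiableOn ℂ g W) (hZ : IsCompact Z) (hZW : Z ⊆ W) (hgZ : ∀ z ∈ W, g z ∈ Z)
    (hray : ∀ n : ℕ, ∀ u : ℂ, u ≠ 0 → ∃ r : ℝ, 0 ≤ r ∧ ∃ z ∈ W, g^[n] z = r * u) : False := by
  obtain ⟨N, hN⟩ := contraction_cover hM hW hWM hg hZ hZW hgZ
  have hNpos : (0 : ℝ) < 1 + N := by positivity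
  set ε := m / (4 * (1 + N) ^ 2) with hε
  have hε0 : 0 < ε := by positivity
  obtain ⟨n, S, hS, hcov⟩ := hN ε hε0
  have hmaps : ∀ z ∈ W, g^[n] z ∈ W := by
    clear hcov
    induction n with
    | zero => intro z hz; exact hz
    | succ n ih =>
      intro z hz
      rw [Function.iterate_succ_apply']
      exact hZW (hgZ _ (ih z hz))
  have hu : ∀ j : ℕ, (1 + j * Complex.I : ℂ) ≠ 0 := by
    intro j h
    have := congrArg Complex.re h
    simp at this
  have key : ∀ j : ℕ, ∃ r : ℝ, 0 ≤ r ∧ ∃ c ∈ S, (r : ℂ) * (1 + j * Complex.I) ∈ W ∧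
      dist ((r : ℂ) * (1 + j * Complex.I)) c < ε := by
    intro j
    obtain ⟨r, hr, z, hz, h⟩ := hray n _ (hu j)
    obtain ⟨c, hc, hd⟩ := hcov z hz
    rw [h] at hd
    have := hmaps z hz
    rw [h] at this
    exact ⟨r, hr, c, hc, this, hd⟩
  choose r hr c hcS hrW hrd using key
  obtain ⟨j, hj, k, hk, hjk, hcjk⟩ := Finset.exists_ne_map_eq_of_card_lt_of_maps_to
    (s := Finset.range (N + 1)) (t := S) (by simpa using Nat.lt_succ_of_le hS)
    (f := c) (fun j _ => hcS j)
  have hd : ‖(r j : ℂ) * (1 + j * Complex.I) - (r k : ℂ) * (1 + k * Complex.I)‖ < 2 * ε := by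
    rw [← dist_eq_norm]
    have h1 := hrd j
    have h2 := hrd k
    rw [← hcjk] at h2
    have := dist_triangle_right ((r j : ℂ) * (1 + j * Complex.I)) ((r k : ℂ) * (1 + k * Complex.I)) (c j)
    linarith
  have h1 : |r j - r k| < 2 * ε := by
    refine lt_of_le_of_lt ?_ hd
    have := Complex.abs_re_le_norm ((r j : ℂ) * (1 + j * Complex.I) - (r k : ℂ) * (1 + k * Complex.I))
    simpa using this
  have h2 : |r j * j - r k * k| < 2 * ε := by
    refine lt_of_le_of_lt ?_ hd
    have := Complex.abs_im_le_norm ((r j : ℂ) * (1 + j * Complex.I) - (r k : ℂ) * (1 + k * Complex.I))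
    simpa using this
  have hjN : (j : ℝ) ≤ N := by exact_mod_cast Nat.lt_succ_iff.1 (Finset.mem_range.1 hj)
  have hkN : (k : ℝ) ≤ N := by exact_mod_cast Nat.lt_succ_iff.1 (Finset.mem_range.1 hk)
  have h3 : m ≤ r j * (1 + N) := by
    refine (hWm _ (hrW j)).trans ?_
    rw [norm_mul, Complex.norm_real, Real.norm_of_nonneg (hr j)]
    apply mul_le_mul_of_nonneg_left _ (hr j)
    refine (norm_add_le _ _).trans ?_
    simp
    exact_mod_cast hjN
  have h4 : (1 : ℝ) ≤ |(j : ℝ) - k| := by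
    have : (1 : ℤ) ≤ |(j : ℤ) - k| := Int.one_le_abs (sub_ne_zero.2 (by exact_mod_cast hjk))
    exact_mod_cast this
  have h5 : r j ≤ 2 * ε * (1 + N) := by
    have e : r j * ((j : ℝ) - k) = (r j * j - r k * k) - (r j - r k) * k := by ring
    have : r j * |(j : ℝ) - k| ≤ |r j * j - r k * k| + |r j - r k| * k := by
      calc r j * |(j : ℝ) - k| = |r j * ((j : ℝ) - k)| := by rw [abs_mul, abs_of_nonneg (hr j)]
        _ ≤ |r j * j - r k * k| + |(r j - r k) * k| := by rw [e]; exact abs_sub _ _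
        _ = _ := by rw [abs_mul, Nat.abs_cast]
    have h6 : |r j - r k| * k ≤ 2 * ε * N := by gcongr
    nlinarith [hr j]
  have h7 : m ≤ 2 * ε * (1 + N) * (1 + N) := h3.trans (by gcongr)
  have h8 : 2 * ε * (1 + N) * (1 + N) = m / 2 := by rw [hε]; field_simp; ring
  linarith

end Contraction

open Filter Topology OnePoint

section Branch

variable {a : ℂ}

/-- complement of the exhaustion in the inversion chart -/
def Yc (a : ℂ) (n : ℕ) : Set ℂ := {u | invChart u ∉ Lc a n}

theorem isOpen_Yc (ha : a ≠ 0) (n : ℕ) : IsOpen (Yc a n) :=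
  (isClosed_Lc ha n).isOpen_compl.preimage continuous_invChart

theorem Yc_anti (ha : a ≠ 0) : Antitone (Yc a) := fun _ _ hmn _ hu h => hu (Lc_mono ha hmn h)

theorem zero_mem_Yc (ha : a ≠ 0) (n : ℕ) : (0 : ℂ) ∈ Yc a n := by
  intro h
  rw [invChart_zero] at h
  exact infty_not_mem_Azero ha h.1

/-- `1 - p u` has a square root near the complement of the component -/
def HasBr (a p : ℂ) : Prop :=
  ∃ n, ∃ s : ℂ → ℂ, ContinuousOn s (Yc a n) ∧ ∀ u ∈ Yc a n, s u ^ 2 = 1 - p * u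

theorem HasBr_step (ha : a ≠ 0) {p p' : ℂ} {δ : ℝ} {n : ℕ} (hd : dist p' p < δ)
    (hb : ∀ z ∈ Metric.ball p (2 * δ), (z : OnePoint ℂ) ∈ Lc a n) (h : HasBr a p) :
    HasBr a p' := by
  obtain ⟨m, s, hs, hs2⟩ := h
  have hδ : 0 < δ := lt_of_le_of_lt dist_nonneg hd
  have hYm : Yc a (max m n) ⊆ Yc a m := Yc_anti ha (le_max_left _ _)
  have hYn : Yc a (max m n) ⊆ Yc a n := Yc_anti ha (le_max_right _ _)
  have hne : ∀ u ∈ Yc a n, 1 - p * u ≠ 0 ∧ (1 - p' * u) / (1 - p * u) ∈ Complex.slitPlane := by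
    intro u hu
    by_cases hu0 : u = 0
    · subst hu0; simp
    have hw : 2 * δ ≤ ‖u⁻¹ - p‖ := by
      by_contra hlt
      push Not at hlt
      apply hu
      rw [invChart, if_neg hu0]
      exact hb _ (by rwa [Metric.mem_ball, dist_eq_norm])
    have hw0 : u⁻¹ - p ≠ 0 := by
      intro h0; rw [h0, norm_zero] at hw; linarith
    have e1 : 1 - p * u = u * (u⁻¹ - p) := by field_simp
    have hne : 1 - p * u ≠ 0 := by rw [e1]; exact mul_ne_zero hu0 hw0
    refine ⟨hne, ?_⟩
    have e2 : (1 - p' * u) / (1 - p * u) = 1 + (-(p' - p) / (u⁻¹ - p)) := by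
      have e3 : 1 - p' * u = u * (u⁻¹ - p') := by field_simp
      rw [e1, e3, mul_div_mul_left _ _ hu0]
      generalize u⁻¹ = x at hw0
      field_simp
      ring
    rw [e2]
    apply Complex.mem_slitPlane_of_norm_lt_one
    rw [norm_div, norm_neg, div_lt_one (by linarith), ← dist_eq_norm]
    linarith
  refine ⟨max m n, fun u => s u * Complex.exp (Complex.log ((1 - p' * u) / (1 - p * u)) / 2), ?_, ?_⟩
  · refine (hs.mono hYm).mul (Complex.continuous_exp.comp_continuousOn ?_)
    refine ContinuousOn.div_const ?_ _
    refine ContinuousOn.clog ?_ fun u hu => (hne u (hYn hu)).2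
    refine ContinuousOn.div (by fun_prop) (by fun_prop) fun u hu => (hne u (hYn hu)).1
  · intro u hu
    have h1 := hne u (hYn hu)
    have h2 : Complex.exp (Complex.log ((1 - p' * u) / (1 - p * u)) / 2) ^ 2
        = (1 - p' * u) / (1 - p * u) := by
      rw [← Complex.exp_nat_mul]
      push_cast
      rw [mul_div_cancel₀ _ (two_ne_zero), Complex.exp_log (Complex.slitPlane_ne_zero h1.2)]
    rw [mul_pow, h2, hs2 u (hYm hu)]
    field_simp [h1.1]

theorem HasBr_all (ha : a ≠ 0) {q : ℂ} (hq : (q : OnePoint ℂ) ∈ Azero a) : HasBr a q := by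
  let G : OnePoint ℂ → Prop := fun x => ∀ p : ℂ, x = (p : OnePoint ℂ) → HasBr a p
  have hG : ∀ p : ℂ, G (p : OnePoint ℂ) ↔ HasBr a p := by
    intro p
    constructor
    · intro h; exact h p rfl
    · intro h p' hp'
      rw [OnePoint.coe_injective hp'.symm]; exact h
  have key : G ((0 : ℂ) : OnePoint ℂ) ↔ G (q : OnePoint ℂ) := by
    refine (isPreconnected_Azero a).induction₂' (fun x y => G x ↔ G y) ?_
      (fun x y z _ _ _ h1 h2 => h1.trans h2) (zero_mem_Azero ha) hq
    intro x hx
    obtain ⟨p, rfl⟩ : ∃ p : ℂ, (p : OnePoint ℂ) = x :=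
      OnePoint.ne_infty_iff_exists.1 (fun h => infty_not_mem_Azero ha (h ▸ hx))
    obtain ⟨n, hn⟩ := exists_mem_Lo ha hx
    obtain ⟨ε, hε, hb⟩ := Metric.isOpen_iff.1
      ((isOpen_Lo ha n).preimage OnePoint.continuous_coe) p hn
    have hnhds : ((↑) '' Metric.ball p (ε / 3) : Set (OnePoint ℂ)) ∈ 𝓝 (p : OnePoint ℂ) :=
      OnePoint.isOpenEmbedding_coe.isOpenMap.image_mem_nhds (Metric.ball_mem_nhds p (by positivity))
    filter_upwards [mem_nhdsWithin_of_mem_nhds hnhds]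
    rintro _ ⟨p', hp', rfl⟩
    rw [Metric.mem_ball] at hp'
    have : HasBr a p ↔ HasBr a p' := by
      constructor
      · refine HasBr_step ha (n := n) hp' fun z hz => Lo_sub_Lc a n (hb ?_)
        rw [Metric.mem_ball] at hz ⊢
        linarith
      · refine HasBr_step ha (δ := ε / 3) (n := n) (by rwa [dist_comm]) fun z hz => Lo_sub_Lc a n (hb ?_)
        rw [Metric.mem_ball] at hz ⊢
        linarith [dist_triangle z p' p]
    rw [hG, hG]
    exact ⟨this, this.symm⟩
  rw [hG, hG] at key
  exact key.1 ⟨0, fun _ => 1, continuousOn_const, fun u _ => by simp⟩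

theorem exists_branch (ha : a ≠ 0) (h : ((-a : ℂ) : OnePoint ℂ) ∈ Azero a) :
    ∃ n, ((-a : ℂ) : OnePoint ℂ) ∈ Lc a n ∧ ∃ s : ℂ → ℂ, ContinuousOn s (Yc a n) ∧
      (∀ u ∈ Yc a n, s u ^ 2 = 1 + a * u) ∧ s 0 = 1 := by
  obtain ⟨n, s, hs, hs2⟩ := HasBr_all ha h
  obtain ⟨m, hm⟩ := exists_mem_Lo ha h
  have hY : Yc a (max n m) ⊆ Yc a n := Yc_anti ha (le_max_left _ _)
  have h0 : s 0 ^ 2 = 1 := by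
    rw [hs2 0 (zero_mem_Yc ha n)]; ring
  refine ⟨max n m, Lc_mono ha (le_max_right _ _) (Lo_sub_Lc a m hm), fun u => s u * s 0,
    (hs.mono hY).mul continuousOn_const, fun u hu => ?_, ?_⟩
  · rw [mul_pow, h0, hs2 u (hY hu)]; ring
  · show s 0 * s 0 = 1
    rw [← sq, h0]

end Branch

section Separation

/-- Abstract separation argument. -/
theorem separation {X : Type*} [TopologicalSpace X] [CompactSpace X] [T2Space X]
    {R F : X → X} {K E : Set X} (hR : Continuous R) (hK : IsClosed K)
    (hF : ContinuousOn F Kᶜ) (hRF : ∀ z ∉ K, R (F z) = z)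
    (hE : ∀ z, z ∈ E ↔ R z ∉ K ∧ F (R z) = z) (hEo : IsOpen E) (hKE : K ⊆ E)
    (hRK : ∀ z ∈ K, R z ∉ E) (n : ℕ) :
    ∃ O O' : Set X, IsOpen O ∧ IsOpen O' ∧ O ⊆ Kᶜ ∧ O' ⊆ E ∧ (∀ z, z ∈ O ∨ z ∈ O') ∧
      ∀ z, z ∈ O → z ∈ O' → ∃ w ∈ E \ K, F^[n] w = z := by
  induction n with
  | zero =>
    refine ⟨Kᶜ, E, hK.isOpen_compl, hEo, subset_rfl, subset_rfl, fun z => ?_, fun z h1 h2 => ?_⟩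
    · by_cases h : z ∈ K
      · exact Or.inr (hKE h)
      · exact Or.inl h
    · exact ⟨z, ⟨h2, h1⟩, rfl⟩
  | succ n ih =>
    obtain ⟨O, O', hO, hO', hOK, hO'E, hcov, hmeet⟩ := ih
    have hC : O'ᶜ ⊆ O := fun z hz => (hcov z).resolve_right hz
    have hcl : IsClosed (F '' O'ᶜ) :=
      (hO'.isClosed_compl.isCompact.image_of_continuousOn (hF.mono (hC.trans hOK))).isClosed
    have hFE : ∀ z ∉ K, F z ∈ E := fun z hz => (hE _).2 ⟨by rwa [hRF z hz], by rw [hRF z hz]⟩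
    refine ⟨(F '' O'ᶜ)ᶜ, E ∩ R ⁻¹' O, hcl.isOpen_compl, hEo.inter (hO.preimage hR), ?_,
      Set.inter_subset_left, ?_, ?_⟩
    · intro z hz hzK
      apply hz
      exact ⟨R z, fun h => hRK z hzK (hO'E h), ((hE z).1 (hKE hzK)).2⟩
    · intro z
      by_cases h : z ∈ F '' O'ᶜ
      · right
        obtain ⟨c, hc, rfl⟩ := h
        have hcO := hC hc
        exact ⟨hFE c (hOK hcO), by rw [Set.mem_preimage, hRF c (hOK hcO)]; exact hcO⟩
      · exact Or.inl h
    · rintro z hz ⟨hzE, hzO⟩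
      have hFz := ((hE z).1 hzE).2
      have h1 : R z ∈ O' := by
        by_contra h
        exact hz ⟨R z, h, hFz⟩
      obtain ⟨w, hw, hwz⟩ := hmeet (R z) hzO h1
      exact ⟨w, hw, by rw [Function.iterate_succ_apply', hwz, hFz]⟩

end Separation

section ClaimOne

variable {a : ℂ}

theorem isPreconnected_ray (u : ℂ) :
    IsPreconnected ((fun r : ℝ => (((r : ℂ) * u : ℂ) : OnePoint ℂ)) '' Set.Ici 0) := by
  refine isPreconnected_Ici.image _ ?_
  apply Continuous.continuousOn
  exact OnePoint.continuous_coe.comp (by fun_prop)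

theorem critical_value_not_mem (ha : a ≠ 0) : ((-a : ℂ) : OnePoint ℂ) ∉ Azero a := by
  intro hmem
  obtain ⟨n, haK, s, hs, hs2, hs0⟩ := exists_branch ha hmem
  set K := Lc a n with hKdef
  have hKcl : IsClosed K := isClosed_Lc ha n
  have hKo := isOpen_Lo ha n
  have hoK : Lo a n ⊆ K := Lo_sub_Lc a n
  have h0K : ((0 : ℂ) : OnePoint ℂ) ∈ K := hoK (zero_mem_Lo ha n)
  have hRc := continuous_Rhat ha
  -- inverse coordinate
  let F : OnePoint ℂ → OnePoint ℂ := fun z =>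
    match z with
    | ∞ => ((0 : ℂ) : OnePoint ℂ)
    | (w : ℂ) => ((s w⁻¹ - 1 : ℂ) : OnePoint ℂ)
  let f : ℂ → ℂ := fun w => s w⁻¹ - 1
  have hFcoe : ∀ w : ℂ, F (w : OnePoint ℂ) = ((f w : ℂ) : OnePoint ℂ) := fun w => rfl
  have hFinv : ∀ u : ℂ, F (invChart u) = iotaB (s u) := by
    intro u
    rw [invChart]
    split_ifs with hu
    · show ((0 : ℂ) : OnePoint ℂ) = _
      rw [hu, iotaB, hs0, sub_self]
    · rw [hFcoe, iotaB]; simp only [f, inv_inv]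
  have hYo := isOpen_Yc ha n
  have hF : ContinuousOn F Kᶜ := by
    intro z hz
    obtain ⟨u, rfl⟩ := mem_range_invChart (z := z) (fun h => hz (h ▸ h0K))
    apply ContinuousAt.continuousWithinAt
    rw [← isOpenEmbedding_invChart.continuousAt_iff]
    have : F ∘ invChart = fun u => iotaB (s u) := funext hFinv
    rw [this]
    exact isOpenEmbedding_iotaB.continuous.continuousAt.comp
      (hs.continuousAt (hYo.mem_nhds hz))
  have hRF : ∀ z ∉ K, Rhat a (F z) = z := by
    intro z hz
    obtain ⟨u, rfl⟩ := mem_range_invChart (z := z) (fun h => hz (h ▸ h0K))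
    rw [hFinv, Rhat_iotaB ha, hs2 u hz, kapB]
    congr 1
    field_simp
    ring
  have hsne : ∀ u ∈ Yc a n, s u ≠ 0 := by
    intro u hu h0
    have h1 := hs2 u hu
    rw [h0] at h1
    apply hu
    have hu0 : u ≠ 0 := by
      rintro rfl; simp at h1
    rw [invChart, if_neg hu0]
    have : u⁻¹ = -a := by
      have h3 : (-a) * u = 1 := by linear_combination h1
      rw [eq_comm]
      exact eq_inv_of_mul_eq_one_left h3
    rw [this]
    exact haK
  let E : Set (OnePoint ℂ) := {z | Rhat a z ∉ K ∧ F (Rhat a z) = z}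
  let q : ℂ → ℂ := fun v => (v ^ 2 - 1) / a
  have hRq : ∀ v, Rhat a (iotaB v) = invChart (q v) := fun v => by rw [Rhat_iotaB ha]; rfl
  have hqs : ∀ v, q v ∈ Yc a n → s (q v) ^ 2 = v ^ 2 := by
    intro v hv
    rw [hs2 _ hv]
    simp only [q]
    field_simp
    ring
  have hqc : Continuous q := by fun_prop
  have hEeq : E = iotaB '' {v | q v ∈ Yc a n ∧ s (q v) + v ≠ 0} := by
    ext z
    constructor
    · rintro ⟨h1, h2⟩
      obtain ⟨v, rfl⟩ := range_iotaB (z := z) (by rintro rfl; exact h1 h0K)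
      rw [hRq] at h1 h2
      rw [hFinv] at h2
      have h3 := isOpenEmbedding_iotaB.injective h2
      refine ⟨v, ⟨h1, ?_⟩, rfl⟩
      have := hsne _ h1
      intro h4
      have h5 : 2 * s (q v) = 0 := by linear_combination h4 + h3
      exact this (by simpa using h5)
    · rintro ⟨v, ⟨h1, h2⟩, rfl⟩
      refine ⟨by rw [hRq]; exact h1, ?_⟩
      rw [hRq, hFinv]
      congr 1
      have h3 := hqs v h1
      have : (s (q v) + v) * (s (q v) - v) = 0 := by linear_combination h3
      rcases mul_eq_zero.1 this with h | h
      · exact absurd h h2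
      · exact sub_eq_zero.1 h
  have hEo : IsOpen E := by
    rw [hEeq]
    apply isOpenEmbedding_iotaB.isOpenMap
    have hVo : IsOpen (q ⁻¹' Yc a n) := hYo.preimage hqc
    have hcont : ContinuousOn (fun v => s (q v) + v) (q ⁻¹' Yc a n) :=
      (hs.comp hqc.continuousOn (fun v hv => hv)).add continuousOn_id
    exact hcont.isOpen_inter_preimage hVo isOpen_ne
  have hKA : K ⊆ Azero a := Set.inter_subset_left
  have hAE : Azero a ⊆ E := by
    have hUo : IsOpen (Rhat a ⁻¹' Kᶜ) := hKcl.isOpen_compl.preimage hRc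
    have hcont : ContinuousOn (fun z => (F (Rhat a z), z)) (Rhat a ⁻¹' Kᶜ) :=
      (hF.comp hRc.continuousOn (fun v hv => hv)).prodMk continuousOn_id
    have hE2 : IsOpen (Rhat a ⁻¹' Kᶜ ∩ {z | F (Rhat a z) ≠ z}) :=
      hcont.isOpen_inter_preimage hUo (isClosed_diagonal (X := OnePoint ℂ)).isOpen_compl
    have hsub : Azero a ⊆ Rhat a ⁻¹' Kᶜ := fun z hz h =>
      Set.disjoint_left.1 (disjoint_Azero_Ainf ha) (hKA h) (Rhat_Azero ha hz)
    refine (isPreconnected_Azero a).subset_left_of_subset_union hEo hE2 ?_ ?_ ?_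
    · rw [Set.disjoint_left]
      intro z h1 h2
      exact h2.2 h1.2
    · intro z hz
      by_cases h : F (Rhat a z) = z
      · exact Or.inl ⟨hsub hz, h⟩
      · exact Or.inr ⟨hsub hz, h⟩
    · refine ⟨_, zero_mem_Azero ha, hsub (zero_mem_Azero ha), ?_⟩
      rw [Rhat_zero]
  have hRK : ∀ z ∈ K, Rhat a z ∉ E := fun z hz h => h.1 (hoK (Tm_Lc ha hz))
  have hsep := separation hRc hKcl hF hRF (fun z => Iff.rfl) hEo (hKA.trans hAE) hRK
  have hFE : ∀ z ∉ K, F z ∈ E := fun z hz => ⟨by rwa [hRF z hz], by rw [hRF z hz]⟩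
  have hFW : ∀ z ∈ E \ K, F z ∈ E \ K := fun z hz =>
    ⟨hFE z hz.2, fun h => hRK _ h (by rw [hRF z hz.2]; exact hz.1)⟩
  have hinfE : ∞ ∉ E := fun h => h.1 h0K
  -- compactness
  let Z1 : Set (OnePoint ℂ) := {z | Tm a z ∉ Lo a n}
  have hZ1c : IsClosed Z1 := (hKo.preimage (continuous_Tm ha)).isClosed_compl
  have hZ1K : ∀ z ∈ Z1, z ∉ K := fun z hz h => hz (Tm_Lc ha h)
  have hFZ1 : ∀ z ∈ E \ K, F z ∈ Z1 := by
    intro z hz h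
    rw [Tm, hRF z hz.2] at h
    exact hz.1.1 (hoK h)
  let Z : Set (OnePoint ℂ) := F '' Z1 ∩ Z1
  have hZc : IsCompact Z :=
    (hZ1c.isCompact.image_of_continuousOn (hF.mono hZ1K)).inter_right hZ1c
  have hZW : Z ⊆ E \ K := by
    rintro _ ⟨⟨z, hz, rfl⟩, hz2⟩
    exact ⟨hFE z (hZ1K z hz), hZ1K _ hz2⟩
  have hgZ : ∀ z ∈ E \ K, F (F z) ∈ Z := fun z hz =>
    ⟨⟨F z, hFZ1 z hz, rfl⟩, hFZ1 _ (hFW z hz)⟩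
  -- bounds
  obtain ⟨M, hM⟩ : ∃ M : ℝ, ∀ z : ℂ, (z : OnePoint ℂ) ∈ E \ K → ‖z‖ ≤ M := by
    have h1 : Rhat a ⁻¹' (Lo a n) ∈ 𝓝 (∞ : OnePoint ℂ) :=
      (hKo.preimage hRc).mem_nhds (zero_mem_Lo ha n)
    have h2 := tendsto_coe_cobounded h1
    rw [mem_map, ← compl_compl (OnePoint.some ⁻¹' (Rhat a ⁻¹' Lo a n)), ← Bornology.isBounded_def,
      isBounded_iff_forall_norm_le] at h2
    obtain ⟨M, hM⟩ := h2
    refine ⟨M, fun z hz => hM z fun h => hz.1.1 (hoK h)⟩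
  obtain ⟨m, hm0, hm⟩ : ∃ m : ℝ, 0 < m ∧ ∀ z : ℂ, (z : OnePoint ℂ) ∈ E \ K → m ≤ ‖z‖ := by
    obtain ⟨ε, hε, hb⟩ := Metric.isOpen_iff.1 (hKo.preimage OnePoint.continuous_coe) 0
      (zero_mem_Lo ha n)
    refine ⟨ε, hε, fun z hz => ?_⟩
    by_contra hlt
    push Not at hlt
    exact hz.2 (hoK (hb (by simpa using hlt)))
  have hWo : IsOpen ((↑) ⁻¹' (E \ K) : Set ℂ) :=
    (hEo.sdiff hKcl).preimage OnePoint.continuous_coe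
  have hZ'c : IsCompact ((↑) ⁻¹' Z : Set ℂ) := by
    rw [OnePoint.isOpenEmbedding_coe.isInducing.isCompact_iff, Set.image_preimage_eq_of_subset]
    · exact hZc
    · intro z hz
      exact OnePoint.ne_infty_iff_exists.1 fun h => hinfE (h ▸ (hZW hz).1)
  have hfd : DifferentiableOn ℂ f ((↑) ⁻¹' (E \ K)) := by
    intro w hw
    have hw0 : w ≠ 0 := by rintro rfl; exact hw.2 h0K
    have hY : w⁻¹ ∈ Yc a n := by
      intro h
      rw [invChart, if_neg (inv_ne_zero hw0), inv_inv] at h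
      exact hw.2 h
    have hd : DifferentiableAt ℂ s w⁻¹ := by
      have h1 : HasDerivAt (fun x : ℂ => (x ^ 2 - 1) / a) (2 * s w⁻¹ / a) (s w⁻¹) := by
        have := ((hasDerivAt_pow 2 (s w⁻¹)).sub_const 1).div_const a
        simpa using this
      refine (HasDerivAt.of_local_left_inverse (hs.continuousAt (hYo.mem_nhds hY)) h1
        (div_ne_zero (mul_ne_zero two_ne_zero (hsne _ hY)) ha) ?_).differentiableAt
      filter_upwards [hYo.mem_nhds hY] with y hy
      rw [hs2 y hy]
      field_simp
      ring
    exact ((hd.comp w (differentiableAt_inv hw0)).sub_const 1).differentiableWithinAt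
  have hfW : ∀ w : ℂ, (w : OnePoint ℂ) ∈ E \ K → ((f w : ℂ) : OnePoint ℂ) ∈ E \ K :=
    fun w hw => hFW _ hw
  have hiter : ∀ (k : ℕ) (w : ℂ), F^[k] (w : OnePoint ℂ) = ((f^[k] w : ℂ) : OnePoint ℂ) := by
    intro k
    induction k with
    | zero => intro w; rfl
    | succ k ih => intro w; rw [Function.iterate_succ_apply, hFcoe, ih, Function.iterate_succ_apply]
  refine contraction_no_rays (W := OnePoint.some ⁻¹' (E \ K)) (Z := OnePoint.some ⁻¹' Z) (g := f ∘ f)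
    (M := max M 1) (m := m) (by positivity) hm0 hWo (fun z hz => (hM z hz).trans (le_max_left _ _)) hm
    (hfd.comp hfd hfW) hZ'c (fun z hz => hZW hz) (fun z hz => hgZ _ hz) ?_
  intro k u hu
  obtain ⟨O, O', hO, hO', hOK, hO'E, hcov, hmeet⟩ := hsep (2 * k)
  have hpre := isPreconnected_ray u O O' hO hO' (fun z _ => hcov z) ?_ ?_
  · obtain ⟨_, ⟨r, hr, rfl⟩, h1, h2⟩ := hpre
    obtain ⟨w, hw, hwz⟩ := hmeet _ h1 h2
    obtain ⟨w, rfl⟩ : ∃ p : ℂ, (p : OnePoint ℂ) = w :=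
      OnePoint.ne_infty_iff_exists.1 (fun h => hinfE (h ▸ hw.1))
    refine ⟨r, hr, w, hw, ?_⟩
    rw [hiter] at hwz
    have h3 : f^[2 * k] w = r * u := OnePoint.coe_injective hwz
    rw [← h3, Function.iterate_mul]
    rfl
  · have h1 : ∞ ∈ O := (hcov ∞).resolve_right fun h => hinfE (hO'E h)
    have h2 : Tendsto (fun r : ℝ => (r : ℂ) * u) atTop (Bornology.cobounded ℂ) := by
      rw [← tendsto_norm_atTop_iff_cobounded]
      simp only [norm_mul, Complex.norm_real]
      exact tendsto_norm_atTop_atTop.atTop_mul_const (norm_pos_iff.2 hu)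
    obtain ⟨r, hr1, hr2⟩ := (((tendsto_coe_cobounded.comp h2).eventually (hO.mem_nhds h1)).and
      (eventually_ge_atTop 0)).exists
    exact ⟨_, ⟨r, hr2, rfl⟩, hr1⟩
  · refine ⟨((0 : ℂ) : OnePoint ℂ), ⟨0, Set.self_mem_Ici, by simp⟩, ?_⟩
    exact (hcov _).resolve_left fun h => hOK h h0K

end ClaimOne

open Filter Topology OnePoint

section Lifting

theorem isSimplyConnected_univ_complex : IsSimplyConnected (Set.univ : Set ℂ) :=
  (Homeomorph.Set.univ ℂ).toHomotopyEquiv.simplyConnectedSpace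

theorem exists_sqrt {φ : ℂ → ℂ} (hφ : Continuous φ) (h0 : ∀ z, φ z ≠ 0) :
    ∃ σ : ℂ → ℂ, Continuous σ ∧ ∀ z, σ z ^ 2 = φ z := by
  obtain ⟨f, hf, hf2⟩ := Complex.exists_continuousOn_pow_eq isSimplyConnected_univ_complex isOpen_univ
    hφ.continuousOn (by rintro ⟨z, _, hz⟩; exact h0 z hz) two_ne_zero
  exact ⟨f, continuousOn_univ.1 hf, hf2⟩

theorem sqrt_nhds_le {σ h : ℂ → ℂ} {x : ℂ} (hσ : ContinuousAt σ x) (h0 : σ x ≠ 0)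
    (hsq : ∀ y, σ y ^ 2 = h y) (hh : 𝓝 (h x) ≤ map h (𝓝 x)) : 𝓝 (σ x) ≤ map σ (𝓝 x) := by
  intro U hU
  rw [mem_map] at hU
  have hpos : 0 < ‖σ x‖ := norm_pos_iff.2 h0
  have h1 : σ ⁻¹' U ∩ {y | ‖σ y - σ x‖ < ‖σ x‖} ∈ 𝓝 x := by
    refine inter_mem hU ?_
    have := hσ (Metric.ball_mem_nhds (σ x) hpos)
    filter_upwards [this] with y hy
    rwa [Set.mem_preimage, Metric.mem_ball, dist_eq_norm] at hy
  have h2 : h '' (σ ⁻¹' U ∩ {y | ‖σ y - σ x‖ < ‖σ x‖}) ∈ 𝓝 (h x) := hh (image_mem_map h1)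
  have h3 : ContinuousAt (fun v : ℂ => v ^ 2) (σ x) := by fun_prop
  rw [← hsq x] at h2
  have h4 := h3.preimage_mem_nhds h2
  filter_upwards [h4, Metric.ball_mem_nhds (σ x) hpos] with v hv hv2
  obtain ⟨y, ⟨hyU, hy⟩, hyv⟩ := hv
  rw [Metric.mem_ball, dist_eq_norm] at hv2
  have h5 : σ y ^ 2 = v ^ 2 := by rw [hsq, hyv]
  rcases sq_eq_sq_iff_eq_or_eq_neg.1 h5 with h | h
  · rw [← h]; exact hyU
  · exfalso
    have e : 2 * σ x = -((σ y - σ x) + (v - σ x)) := by rw [h]; ring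
    have : ‖2 * σ x‖ < 2 * ‖σ x‖ := by
      rw [e, norm_neg]
      refine lt_of_le_of_lt (norm_add_le _ _) ?_
      have : ‖σ y - σ x‖ < ‖σ x‖ := hy
      linarith
    rw [norm_mul] at this
    norm_num at this

theorem sqrt_unramified {φ : ℂ → ℂ} (hφ : IsOpenEmbedding φ) (h0 : ∀ z, φ z ≠ 0) {β : ℂ}
    (hβ : β ^ 2 = φ 0) :
    ∃ σ : ℂ → ℂ, IsOpenEmbedding σ ∧ (∀ z, σ z ^ 2 = φ z) ∧ σ 0 = β := by
  have main : ∀ σ : ℂ → ℂ, Continuous σ → (∀ z, σ z ^ 2 = φ z) → IsOpenEmbedding σ := by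
    intro σ hσ hσ2
    refine IsOpenEmbedding.of_continuous_injective_isOpenMap hσ ?_ ?_
    · intro x y hxy
      apply hφ.injective
      rw [← hσ2, ← hσ2, hxy]
    · rw [isOpenMap_iff_nhds_le]
      intro x
      refine sqrt_nhds_le hσ.continuousAt ?_ hσ2 ?_
      · intro h
        apply h0 x
        rw [← hσ2, h]; norm_num
      · exact hφ.isOpenMap.nhds_le x
  obtain ⟨σ, hσ, hσ2⟩ := exists_sqrt hφ.continuous h0
  rcases sq_eq_sq_iff_eq_or_eq_neg.1 ((hσ2 0).trans hβ.symm) with h | h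
  · exact ⟨σ, main σ hσ hσ2, hσ2, h⟩
  · have h2 : ∀ z, (-σ z) ^ 2 = φ z := fun z => by rw [neg_sq, hσ2]
    exact ⟨fun z => -σ z, main _ hσ.neg h2, h2, by simp [h]⟩

theorem continuousAt_comp_log {m : ℂ → ℂ} (hm : Continuous m)
    (hper : ∀ x y, Complex.exp x = Complex.exp y → m x = m y) {z : ℂ} (hz : z ≠ 0) :
    ContinuousAt (fun w => m (Complex.log w)) z := by
  have h1 : ContinuousAt (fun w => m (Complex.log z + Complex.log (w / z))) z := by
    refine hm.continuousAt.comp ?_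
    refine continuousAt_const.add ?_
    refine ContinuousAt.clog (by fun_prop) ?_
    rw [div_self hz]
    exact Complex.one_mem_slitPlane
  refine h1.congr ?_
  filter_upwards [isOpen_ne.mem_nhds hz] with w hw
  have hw0 : w ≠ 0 := hw
  apply hper
  rw [Complex.exp_add, Complex.exp_log hz, Complex.exp_log hw0,
    Complex.exp_log (div_ne_zero hw0 hz)]
  field_simp

theorem no_sqrt_near_zero {S : ℂ → ℂ} {ρ : ℝ} (hρ : 0 < ρ)
    (hS : ContinuousOn S (Metric.ball 0 ρ \ {0})) (hS2 : ∀ w ∈ Metric.ball 0 ρ \ {0}, S w ^ 2 = w) :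
    False := by
  let c : ℝ → ℂ := fun θ => ((ρ / 2 : ℝ) : ℂ) * Complex.exp (θ * Complex.I)
  have hc : ∀ θ, c θ ∈ Metric.ball 0 ρ \ {0} := by
    intro θ
    have hn : ‖c θ‖ = ρ / 2 := by
      simp only [c, norm_mul, Complex.norm_real, Complex.norm_exp_ofReal_mul_I, mul_one]
      exact Real.norm_of_nonneg (by positivity)
    refine ⟨by rw [mem_ball_zero_iff, hn]; linarith, ?_⟩
    intro h
    rw [Set.mem_singleton_iff.1 h, norm_zero] at hn
    linarith
  have hcc : Continuous c := by fun_prop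
  let k : ℝ → ℂ := fun θ => S (c θ) * Complex.exp (-(θ * Complex.I) / 2)
  have hk : Continuous k := by
    have : Continuous fun θ => S (c θ) := hS.comp_continuous hcc hc
    exact this.mul (by fun_prop)
  have hk2 : ∀ θ, k θ ^ 2 = ((ρ / 2 : ℝ) : ℂ) := by
    intro θ
    simp only [k]
    rw [mul_pow, hS2 _ (hc θ), ← Complex.exp_nat_mul]
    simp only [c]
    rw [mul_assoc, ← Complex.exp_add]
    push_cast
    rw [show (θ : ℂ) * Complex.I + 2 * (-(θ * Complex.I) / 2) = 0 by ring, Complex.exp_zero, mul_one]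
  have hk0 : k 0 ≠ 0 := by
    intro h
    have := hk2 0
    rw [h] at this
    have h3 : ((ρ / 2 : ℝ) : ℂ) = 0 := by rw [← this]; norm_num
    rw [Complex.ofReal_eq_zero] at h3
    linarith
  have hconst : k (2 * Real.pi) = k 0 :=
    isPreconnected_univ.eq_of_sq_eq (f := k) (g := fun _ => k 0) hk.continuousOn continuousOn_const
      (fun θ _ => by simp [hk2]) (fun _ => hk0) (Set.mem_univ 0) rfl (Set.mem_univ _)
  have h1 : k (2 * Real.pi) = - k 0 := by
    simp only [k, c]
    push_cast
    rw [Complex.exp_two_pi_mul_I, show -(2 * (Real.pi : ℂ) * Complex.I) / 2 = -(Real.pi * Complex.I) by ring,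
      Complex.exp_neg, Complex.exp_pi_mul_I]
    norm_num
  rw [h1] at hconst
  have : k 0 + k 0 = 0 := by linear_combination -hconst
  exact hk0 (by simpa [← two_mul] using this)

theorem sqrt_ramified {φ : ℂ → ℂ} (hφ : IsOpenEmbedding φ) (h0 : φ 0 = 0) :
    ∃ σ : ℂ → ℂ, IsOpenEmbedding σ ∧ (∀ z, σ z ^ 2 = φ (z ^ 2)) ∧
      ∀ v, v ^ 2 ∈ Set.range φ → v ∈ Set.range σ := by
  have hφne : ∀ z, z ≠ 0 → φ z ≠ 0 := fun z hz h => hz (hφ.injective (h.trans h0.symm))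
  obtain ⟨μ, hμ, hμ2⟩ := exists_sqrt (φ := fun ζ => φ (Complex.exp ζ ^ 2))
    (hφ.continuous.comp (by fun_prop)) (fun ζ => hφne _ (pow_ne_zero _ (Complex.exp_ne_zero ζ)))
  have hμne : ∀ ζ, μ ζ ≠ 0 := by
    intro ζ h
    apply hφne _ (pow_ne_zero 2 (Complex.exp_ne_zero ζ))
    rw [← hμ2, h]; norm_num
  have hsign := isPreconnected_univ.eq_or_eq_neg_of_sq_eq (f := fun ζ => μ (ζ + Real.pi * Complex.I))
    (g := μ) (by fun_prop) hμ.continuousOn (fun ζ _ => by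
      simp only [Pi.pow_apply]
      rw [hμ2, hμ2, Complex.exp_add, Complex.exp_pi_mul_I]
      congr 1
      ring) (fun {ζ} _ => hμne ζ)
  have hper2 : ∀ ζ, μ (ζ + 2 * Real.pi * Complex.I) = μ ζ := by
    intro ζ
    have e : ζ + 2 * Real.pi * Complex.I = (ζ + Real.pi * Complex.I) + Real.pi * Complex.I := by ring
    rw [e]
    rcases hsign with h | h
    · have h1 : ∀ ζ, μ (ζ + Real.pi * Complex.I) = μ ζ := fun ζ => h (Set.mem_univ ζ)
      rw [h1, h1]
    · have h1 : ∀ ζ, μ (ζ + Real.pi * Complex.I) = -μ ζ := fun ζ => h (Set.mem_univ ζ)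
      rw [h1, h1, neg_neg]
  have hexp : ∀ x y, Complex.exp x = Complex.exp y → μ x = μ y := by
    intro x y hxy
    obtain ⟨n, hn⟩ := Complex.exp_eq_exp_iff_exists_int.1 hxy
    have hp : Function.Periodic μ (2 * Real.pi * Complex.I) := hper2
    rw [hn]
    exact hp.int_mul n y
  have hodd : ∀ ζ, μ (ζ + Real.pi * Complex.I) = -μ ζ := by
    rcases hsign with h | h
    · exfalso
      have h1 : ∀ ζ, μ (ζ + Real.pi * Complex.I) = μ ζ := fun ζ => h (Set.mem_univ ζ)
      have hp : Function.Periodic μ (Real.pi * Complex.I) := h1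
      -- the function descends
      have hS1 : ∀ z : ℂ, z ≠ 0 → ContinuousAt (fun w => μ (Complex.log w / 2)) z := by
        intro z hz
        refine continuousAt_comp_log (m := fun x => μ (x / 2)) (by fun_prop) ?_ hz
        intro x y hxy
        obtain ⟨n, hn⟩ := Complex.exp_eq_exp_iff_exists_int.1 hxy
        rw [hn]
        have := hp.int_mul n (y / 2)
        rw [← this]
        congr 1
        ring
      obtain ⟨ρ, hρ, hball⟩ := Metric.isOpen_iff.1 hφ.isOpen_range 0 ⟨0, h0⟩
      let e := hφ.toOpenPartialHomeomorph φ
      have he : ∀ w ∈ Metric.ball (0 : ℂ) ρ, φ (e.symm w) = w := by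
        intro w hw
        exact e.right_inv (x := w) (by simpa [e] using hball hw)
      have hec : ContinuousOn e.symm (Metric.ball 0 ρ) :=
        e.continuousOn_symm.mono (by simpa [e] using hball)
      have hene : ∀ w ∈ Metric.ball (0 : ℂ) ρ \ {0}, e.symm w ≠ 0 := by
        intro w hw h
        have := he w hw.1
        rw [h, h0] at this
        exact hw.2 this.symm
      refine no_sqrt_near_zero hρ (S := fun w => μ (Complex.log (e.symm w) / 2)) ?_ ?_
      · intro w hw
        exact (hS1 _ (hene w hw)).comp_continuousWithinAt
          ((hec.mono Set.sdiff_subset) w hw)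
      · intro w hw
        show μ (Complex.log (e.symm w) / 2) ^ 2 = w
        rw [hμ2, ← Complex.exp_nat_mul]
        push_cast
        rw [mul_div_cancel₀ _ two_ne_zero, Complex.exp_log (hene w hw), he w hw.1]
    · exact fun ζ => h (Set.mem_univ ζ)
  let σ : ℂ → ℂ := fun z => if z = 0 then 0 else μ (Complex.log z)
  have hσ0 : σ 0 = 0 := by simp [σ]
  have hσ2 : ∀ z, σ z ^ 2 = φ (z ^ 2) := by
    intro z
    by_cases hz : z = 0
    · subst hz; simp [hσ0, h0]
    · simp only [σ, if_neg hz]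
      rw [hμ2, Complex.exp_log hz]
  have hσneg : ∀ z, σ (-z) = -σ z := by
    intro z
    by_cases hz : z = 0
    · subst hz; simp [hσ0]
    · have hz' : -z ≠ 0 := neg_ne_zero.2 hz
      simp only [σ, if_neg hz, if_neg hz']
      rw [← hodd]
      apply hexp
      rw [Complex.exp_log hz', Complex.exp_add, Complex.exp_log hz, Complex.exp_pi_mul_I]
      ring
  have hσc : Continuous σ := by
    rw [continuous_iff_continuousAt]
    intro z
    by_cases hz : z = 0
    · subst hz
      rw [ContinuousAt, hσ0, tendsto_zero_iff_norm_tendsto_zero]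
      have h1 : Tendsto (fun z => Real.sqrt ‖φ (z ^ 2)‖) (𝓝 0) (𝓝 0) := by
        have : Continuous fun z => Real.sqrt ‖φ (z ^ 2)‖ :=
          Real.continuous_sqrt.comp ((hφ.continuous.comp (continuous_pow 2)).norm)
        have h2 := this.tendsto 0
        simpa [h0] using h2
      refine h1.congr fun z => ?_
      rw [← hσ2, norm_pow, Real.sqrt_sq (norm_nonneg _)]
    · refine (continuousAt_comp_log hμ hexp hz).congr ?_
      filter_upwards [isOpen_ne.mem_nhds hz] with w hw
      have hw0 : w ≠ 0 := hw
      simp [σ, hw0]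
  have hσne : ∀ z, z ≠ 0 → σ z ≠ 0 := by
    intro z hz
    simp only [σ, if_neg hz]
    exact hμne _
  have hlift : ∀ z v, v ^ 2 = φ (z ^ 2) → v = σ z ∨ v = σ (-z) := by
    intro z v hv
    rw [← hσ2] at hv
    rw [hσneg]
    exact sq_eq_sq_iff_eq_or_eq_neg.1 hv
  refine ⟨σ, IsOpenEmbedding.of_continuous_injective_isOpenMap hσc ?_ ?_, hσ2, ?_⟩
  · intro x y hxy
    have h1 : x ^ 2 = y ^ 2 := hφ.injective (by rw [← hσ2, ← hσ2, hxy])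
    rcases sq_eq_sq_iff_eq_or_eq_neg.1 h1 with h | h
    · exact h
    · rw [h, hσneg] at hxy
      have h2 : σ y = 0 := by
        have : σ y + σ y = 0 := by linear_combination -hxy
        simpa [← two_mul] using this
      by_cases hy : y = 0
      · rw [h, hy, neg_zero]
      · exact absurd h2 (hσne y hy)
  · rw [isOpenMap_iff_nhds_le]
    intro x
    by_cases hx : x = 0
    · subst hx
      rw [hσ0]
      intro U hU
      rw [mem_map] at hU
      obtain ⟨ε, hε, hb⟩ := Metric.mem_nhds_iff.1 hU
      have h1 : φ '' Metric.ball 0 (ε ^ 2) ∈ 𝓝 (φ 0) :=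
        hφ.isOpenMap.image_mem_nhds (Metric.ball_mem_nhds 0 (by positivity))
      have h3 : ContinuousAt (fun v : ℂ => v ^ 2) 0 := by fun_prop
      have h4 := h3 (by simpa [h0] using h1)
      filter_upwards [h4] with v hv
      obtain ⟨y, hy, hyv⟩ := hv
      obtain ⟨z, hz⟩ := IsSquare.exists_sq y (by
        obtain ⟨z, hz⟩ := IsAlgClosed.exists_pow_nat_eq y (n := 2) two_pos
        exact ⟨z, by rw [← hz, sq]⟩)
      have hzε : ‖z‖ < ε := by
        rw [mem_ball_zero_iff, hz, norm_pow] at hy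
        exact lt_of_pow_lt_pow_left₀ 2 hε.le hy
      rcases hlift z v (by rw [← hz]; exact hyv.symm) with h | h
      · rw [h]; exact hb (by simpa using hzε)
      · rw [h]; exact hb (by simpa using hzε)
    · refine sqrt_nhds_le hσc.continuousAt (hσne x hx) hσ2 ?_
      have hd : HasStrictDerivAt (fun z : ℂ => z ^ 2) (2 * x) x := by
        simpa using hasStrictDerivAt_pow 2 x
      have h1 : map (fun z : ℂ => z ^ 2) (𝓝 x) = 𝓝 (x ^ 2) :=
        hd.map_nhds_eq (mul_ne_zero two_ne_zero hx)
      have h2 : map (fun z => φ (z ^ 2)) (𝓝 x) = map φ (map (fun z : ℂ => z ^ 2) (𝓝 x)) :=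
        (map_map).symm
      rw [h2, h1]
      exact hφ.isOpenMap.nhds_le _
  · rintro v ⟨y, hy⟩
    obtain ⟨z, hz⟩ := IsAlgClosed.exists_pow_nat_eq y (n := 2) two_pos
    rcases hlift z v (by rw [hz]; exact hy.symm) with h | h
    · exact ⟨z, h.symm⟩
    · exact ⟨-z, h.symm⟩

theorem lift_step {X : Type*} [TopologicalSpace X] {R : X → X} {ι κ ψ : ℂ → X}
    (hι : IsOpenEmbedding ι) (hκ : IsOpenEmbedding κ) (hψ : IsOpenEmbedding ψ)
    (hR : ∀ v, R (ι v) = κ (v ^ 2)) (hRι : ∀ z, R z ∈ Set.range κ → z ∈ Set.range ι)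
    (hψκ : ∀ z, ψ z ∈ Set.range κ) {β : ℂ} (hβ : R (ι β) = ψ 0) :
    ∃ χ : ℂ → X, IsOpenEmbedding χ ∧ χ 0 = ι β ∧ (∀ z, R (χ z) ∈ Set.range ψ) ∧
      ∀ C : Set X, IsPreconnected C → ι β ∈ C → (∀ z ∈ C, R z ∈ Set.range ψ) → C ⊆ Set.range χ := by
  choose φ hφψ using hψκ
  have hφ : IsOpenEmbedding φ := by
    refine IsOpenEmbedding.of_comp φ hκ ?_
    have : κ ∘ φ = ψ := funext hφψ
    rw [this]; exact hψ
  have hβ2 : β ^ 2 = φ 0 := hκ.injective (by rw [← hR, hβ, hφψ])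
  have hC0 : ∀ z, R z ∈ Set.range ψ → ∃ v, ι v = z ∧ ∃ x, v ^ 2 = φ x := by
    rintro z ⟨x, hx⟩
    obtain ⟨v, rfl⟩ := hRι z ⟨φ x, by rw [hφψ, hx]⟩
    refine ⟨v, rfl, x, hκ.injective ?_⟩
    rw [← hR, hφψ, hx]
  by_cases h0 : ∃ c, φ c = 0
  · obtain ⟨c, hc⟩ := h0
    obtain ⟨σ, hσ, hσ2, hσr⟩ := sqrt_ramified (φ := fun z => φ (z + c))
      (hφ.comp (Homeomorph.addRight c).isOpenEmbedding) (by simpa using hc)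
    have hrange : ∀ v x, v ^ 2 = φ x → ∃ d, σ d = v := fun v x hv =>
      hσr v ⟨x - c, by simp [hv]⟩
    obtain ⟨d, hd⟩ := hrange β 0 hβ2
    refine ⟨fun z => ι (σ (z + d)), (hι.comp hσ).comp (Homeomorph.addRight d).isOpenEmbedding,
      by simp [hd], fun z => ⟨(z + d) ^ 2 + c, ?_⟩, ?_⟩
    · rw [hR, hσ2, hφψ]
    · intro C _ _ hC z hz
      obtain ⟨v, rfl, x, hx⟩ := hC0 z (hC z hz)
      obtain ⟨y, hy⟩ := hrange v x hx
      exact ⟨y - d, by simp [hy]⟩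
  · push Not at h0
    obtain ⟨σ, hσ, hσ2, hσ0⟩ := sqrt_unramified hφ h0 hβ2
    refine ⟨fun z => ι (σ z), hι.comp hσ, by simp [hσ0], fun z => ⟨z, ?_⟩, ?_⟩
    · rw [hR, hσ2, hφψ]
    · intro C hCp hβC hC
      have hn : IsOpenEmbedding (fun z => ι (-σ z)) :=
        (hι.comp (Homeomorph.neg ℂ).isOpenEmbedding).comp hσ
      refine hCp.subset_left_of_subset_union (hι.comp hσ).isOpen_range hn.isOpen_range ?_ ?_
        ⟨_, hβC, 0, by simp [hσ0]⟩
      · rw [Set.disjoint_left]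
        rintro _ ⟨x, rfl⟩ ⟨y, hy⟩
        have h1 : -σ y = σ x := hι.injective hy
        have h2 : y = x := hφ.injective (by rw [← hσ2, ← hσ2, ← h1, neg_sq])
        rw [h2] at h1
        have h3 : σ x = 0 := by
          have : σ x + σ x = 0 := by linear_combination -h1
          simpa [← two_mul] using this
        apply h0 x
        rw [← hσ2, h3]; norm_num
      · intro z hz
        obtain ⟨v, rfl, x, hx⟩ := hC0 z (hC z hz)
        rw [← hσ2] at hx
        rcases sq_eq_sq_iff_eq_or_eq_neg.1 hx with h | h
        · exact Or.inl ⟨x, by simp [h]⟩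
        · exact Or.inr ⟨x, by simp [h]⟩

end Lifting

open Filter Topology OnePoint

section Final

variable {a : ℂ}

/-- even stage of the exhaustion -/
def StageE (a : ℂ) (n : ℕ) : Prop :=
  ∃ ψ : ℂ → OnePoint ℂ, IsOpenEmbedding ψ ∧ ψ 0 = ((0 : ℂ) : OnePoint ℂ) ∧
    (∀ z, ψ z ∈ Azero a) ∧ ∀ C : Set (OnePoint ℂ), IsPreconnected C →
      ((0 : ℂ) : OnePoint ℂ) ∈ C → (∀ z ∈ C, (Tm a)^[n] z ∈ Dop a) → C ⊆ Set.range ψ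

/-- odd stage of the exhaustion -/
def StageO (a : ℂ) (n : ℕ) : Prop :=
  ∃ ψ : ℂ → OnePoint ℂ, IsOpenEmbedding ψ ∧ ψ 0 = ∞ ∧
    (∀ z, ψ z ∈ Ainf a) ∧ ∀ C : Set (OnePoint ℂ), IsPreconnected C →
      ∞ ∈ C → (∀ z ∈ C, (Tm a)^[n] (Rhat a z) ∈ Dop a) → C ⊆ Set.range ψ

theorem stageE_zero (ha : a ≠ 0) : StageE a 0 := by
  have hr := rad_pos ha
  let e := OpenPartialHomeomorph.univBall (0 : ℂ) (rad a)
  have he : IsOpenEmbedding e := e.isOpenEmbedding (OpenPartialHomeomorph.univBall_source _ _)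
  have hrange : Set.range e = Metric.ball (0 : ℂ) (rad a) := by
    rw [← OpenPartialHomeomorph.univBall_target (0 : ℂ) hr, ← e.image_source_eq_target,
      OpenPartialHomeomorph.univBall_source, Set.image_univ]
  have hψ : IsOpenEmbedding (fun z => ((e z : ℂ) : OnePoint ℂ)) :=
    OnePoint.isOpenEmbedding_coe.comp he
  have hψ0 : ((e 0 : ℂ) : OnePoint ℂ) = ((0 : ℂ) : OnePoint ℂ) := by
    rw [OpenPartialHomeomorph.univBall_apply_zero]
  have hr2 : Set.range (fun z => ((e z : ℂ) : OnePoint ℂ)) = Dop a := by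
    rw [Dop, ← hrange, ← Set.range_comp]; rfl
  refine ⟨_, hψ, hψ0, ?_, ?_⟩
  · intro z
    refine sub_Azero ha (isPreconnected_range hψ.continuous) ⟨0, hψ0⟩ ?_ ⟨z, rfl⟩
    rw [hr2]
    exact (Dop_sub_Dbar a).trans (Dbar_sub_B0 ha)
  · intro C _ _ hC
    rw [hr2]
    exact hC

theorem stageO_of_E (ha : a ≠ 0) {n : ℕ} (h : StageE a n) : StageO a n := by
  obtain ⟨ψ, hψ, hψ0, hψA, hψC⟩ := h
  have hi : iotaA 0 = ∞ := by rw [iotaA, invChart_zero, trSph_infty]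
  obtain ⟨χ, hχ, hχ0, hχR, hχC⟩ := lift_step (R := Rhat a) (ψ := ψ) (β := 0) isOpenEmbedding_iotaA
    (isOpenEmbedding_kapA ha) hψ (Rhat_iotaA ha) (by
      rintro z ⟨u, hu⟩
      refine range_iotaA ?_
      rintro rfl
      rw [Rhat_neg_one ha] at hu
      exact kapA_ne u hu) (by
      intro z
      refine range_kapA ha ?_
      intro h
      exact critical_value_not_mem ha (h ▸ hψA z)) (by rw [hi, Rhat_infty, hψ0])
  rw [hi] at hχ0 hχC
  refine ⟨χ, hχ, hχ0, ?_, ?_⟩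
  · intro z
    refine sub_Ainf ha (isPreconnected_range hχ.continuous) ⟨0, hχ0⟩ ?_ ⟨z, rfl⟩
    rintro _ ⟨w, rfl⟩
    rw [← Rhat_mem_B0 ha]
    obtain ⟨x, hx⟩ := hχR w
    rw [← hx]
    exact Azero_sub_B0 ha (hψA x)
  · intro C hC hiC hCD
    refine hχC C hC hiC fun z hz => ?_
    refine hψC (Rhat a '' C) (hC.image _ (continuous_Rhat ha).continuousOn) ⟨_, hiC, rfl⟩ ?_ ⟨z, hz, rfl⟩
    rintro _ ⟨w, hw, rfl⟩
    exact hCD w hw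

theorem stageE_succ (ha : a ≠ 0) {n : ℕ} (h : StageO a n) : StageE a (n + 1) := by
  obtain ⟨ψ, hψ, hψ0, hψA, hψC⟩ := h
  have hi : iotaB 1 = ((0 : ℂ) : OnePoint ℂ) := by simp [iotaB]
  obtain ⟨χ, hχ, hχ0, hχR, hχC⟩ := lift_step (R := Rhat a) (ψ := ψ) (β := 1) isOpenEmbedding_iotaB
    (isOpenEmbedding_kapB ha) hψ (Rhat_iotaB ha) (by
      rintro z ⟨u, hu⟩
      refine range_iotaB ?_
      rintro rfl
      rw [Rhat_infty] at hu
      exact kapB_ne u hu) (by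
      intro z
      refine range_kapB ha ?_
      intro h
      exact zero_not_mem_Ainf ha (h ▸ hψA z)) (by rw [hi, Rhat_zero, hψ0])
  rw [hi] at hχ0 hχC
  refine ⟨χ, hχ, hχ0, ?_, ?_⟩
  · intro z
    refine sub_Azero ha (isPreconnected_range hχ.continuous) ⟨0, hχ0⟩ ?_ ⟨z, rfl⟩
    rintro _ ⟨w, rfl⟩
    rw [← Rhat_mem_Binf ha]
    obtain ⟨x, hx⟩ := hχR w
    rw [← hx]
    exact Ainf_sub_Binf ha (hψA x)
  · intro C hC hiC hCD
    refine hχC C hC hiC fun z hz => ?_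
    refine hψC (Rhat a '' C) (hC.image _ (continuous_Rhat ha).continuousOn)
      ⟨_, hiC, Rhat_zero a⟩ ?_ ⟨z, hz, rfl⟩
    rintro _ ⟨w, hw, rfl⟩
    exact hCD w hw

theorem stageE_all (ha : a ≠ 0) (n : ℕ) : StageE a n := by
  induction n with
  | zero => exact stageE_zero ha
  | succ n ih => exact stageE_succ ha (stageO_of_E ha ih)

theorem simplyConnected_of_exhaustion {A : Set (OnePoint ℂ)} (hA : IsOpen A)
    (hAc : IsPreconnected A) {b : OnePoint ℂ} (hb : b ∈ A)
    (h : ∀ C : Set (OnePoint ℂ), IsCompact C → IsPreconnected C → b ∈ C → C ⊆ A →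
      ∃ ψ : ℂ → OnePoint ℂ, IsOpenEmbedding ψ ∧ (∀ z, ψ z ∈ A) ∧ C ⊆ Set.range ψ) :
    IsSimplyConnected A := by
  have hpc : IsPathConnected A := hA.isConnected_iff_isPathConnected.1 ⟨⟨b, hb⟩, hAc⟩
  rw [isSimplyConnected_iff_exists_homotopy_refl_forall_mem]
  refine ⟨hpc, fun x p hp => ?_⟩
  have hx : x ∈ A := by simpa using hp 0
  obtain ⟨q, hq⟩ := hpc.joinedIn b hb x hx
  obtain ⟨ψ, hψ, hψA, hψC⟩ := h (Set.range q ∪ Set.range p)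
    ((isCompact_range q.continuous).union (isCompact_range p.continuous))
    (IsPreconnected.union x ⟨1, by simp⟩ ⟨0, by simp⟩ (isPreconnected_range q.continuous)
      (isPreconnected_range p.continuous))
    (Or.inl ⟨0, by simp⟩)
    (by
      rintro _ (⟨t, rfl⟩ | ⟨t, rfl⟩)
      · exact hq t
      · exact hp t)
  have hsc : IsSimplyConnected (ψ '' Set.univ) :=
    hψ.isEmbedding.isSimplyConnected_image.2 isSimplyConnected_univ_complex
  rw [Set.image_univ, isSimplyConnected_iff_exists_homotopy_refl_forall_mem] at hsc
  obtain ⟨F, hF⟩ := hsc.2 x p fun t => hψC (Or.inr ⟨t, rfl⟩)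
  refine ⟨F, fun t => ?_⟩
  obtain ⟨z, hz⟩ := hF t
  rw [← hz]
  exact hψA z

theorem isSimplyConnected_Azero (ha : a ≠ 0) : IsSimplyConnected (Azero a) := by
  refine simplyConnected_of_exhaustion (isOpen_Azero ha) (isPreconnected_Azero a)
    (zero_mem_Azero ha) fun C hC hCp h0 hCA => ?_
  obtain ⟨n, hn⟩ := compact_sub_Lo ha hC hCA
  obtain ⟨ψ, hψ, -, hψA, hψC⟩ := stageE_all ha n
  exact ⟨ψ, hψ, hψA, hψC C hCp h0 fun z hz => (hn hz).2⟩

theorem isSimplyConnected_Ainf (ha : a ≠ 0) : IsSimplyConnected (Ainf a) := by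
  refine simplyConnected_of_exhaustion (isOpen_Ainf ha) (isPreconnected_Ainf a)
    (infty_mem_Ainf ha) fun C hC hCp h0 hCA => ?_
  obtain ⟨n, hn⟩ := compact_sub_Lo ha (hC.image (continuous_Rhat ha)) (by
    rintro _ ⟨z, hz, rfl⟩
    exact Rhat_Ainf ha (hCA hz))
  obtain ⟨ψ, hψ, -, hψA, hψC⟩ := stageO_of_E ha (stageE_all ha n)
  exact ⟨ψ, hψ, hψA, hψC C hCp h0 fun z hz => (hn ⟨z, hz, rfl⟩).2⟩

end Final

/-- `A_0(a)` and `A_∞(a)` are distinct (in particular disjoint), both simply connected, and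
the critical point `−1` is not in `A_∞(a)`. -/
theorem Azero_Ainf_distinct_simplyConnected (a : ℂ) (ha : a ≠ 0) :
    Azero a ≠ Ainf a ∧ Disjoint (Azero a) (Ainf a) ∧
    SimplyConnectedSpace ↥(Azero a) ∧ SimplyConnectedSpace ↥(Ainf a) ∧
    (((-1 : ℂ) : RSphere) ∉ Ainf a) := by
  refine ⟨fun h => zero_not_mem_Ainf ha (h ▸ zero_mem_Azero ha), disjoint_Azero_Ainf ha,
    isSimplyConnected_Azero ha, isSimplyConnected_Ainf ha, fun h => ?_⟩
  have := Rhat_Ainf ha h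
  rw [Rhat_neg_one ha] at this
  exact critical_value_not_mem ha this
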